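/- Let u(z) = Re ∑_{n=1}^{∞} 2^n z^{2^{2^n}} (the series converges for every z in the open unit disk 𝔻). Then there exists α > 0 such that for Lebesgue-almost every φ ∈ (−π, π], limsup_{R→1⁻} I_u(R,φ) · ( log log(1/(1−R)) · log log log log(1/(1−R)) )^{−1/2} > α. -/

import Mathlib

open MeasureTheory Real Filter Set Metric

/-- The weighted radial average `I_u(R,φ)`. -/
noncomputable def Iu (u : ℂ → ℝ) (R φ : ℝ) : ℝ :=
  ∫ r in (1/2 : ℝ)..R, u ((r : ℂ) * Complex.exp (Complex.I * φ)) /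
    ((1 - r) * (Real.log (1 / (1 - r))) ^ 2)

/-- The function `u(z) = Re ∑_{n≥1} 2ⁿ z^(2^(2ⁿ))`. -/
noncomputable def uEx (z : ℂ) : ℝ :=
  (∑' n : ℕ, (2 : ℂ) ^ (n + 1) * z ^ (2 ^ (2 ^ (n + 1)))).re

open ProbabilityTheory in
/-- A sequence of independent centred random variables with values in `[-1, 1]` and second moment
at least `1 / 2`. -/
structure IsLILSequence {Ω : Type*} [MeasurableSpace Ω] (μ : Measure Ω) (X : ℕ → Ω → ℝ) :
    Prop where
  measurable : ∀ n, Measurable (X n)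
  indep : iIndepFun X μ
  mem_Icc : ∀ n ω, X n ω ∈ Icc (-1 : ℝ) 1
  integral_eq_zero : ∀ n, ∫ ω, X n ω ∂μ = 0
  le_integral_sq : ∀ n, 1 / 2 ≤ ∫ ω, X n ω ^ 2 ∂μ

namespace IsLILSequence

open ProbabilityTheory

variable {Ω : Type*} [MeasurableSpace Ω] {μ : Measure Ω} {X : ℕ → Ω → ℝ}

lemma neg (h : IsLILSequence μ X) : IsLILSequence μ (fun n ω => -X n ω) where
  measurable n := (h.measurable n).neg
  indep := h.indep.comp (fun _ x => -x) (fun _ => measurable_neg)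
  mem_Icc n ω := by have := h.mem_Icc n ω; constructor <;> linarith [this.1, this.2]
  integral_eq_zero n := by rw [integral_neg, h.integral_eq_zero, neg_zero]
  le_integral_sq n := by simpa using h.le_integral_sq n

lemma hasSubgaussianMGF (h : IsLILSequence μ X) (n : ℕ) : HasSubgaussianMGF (X n) 1 μ := by
  have := h.indep.isProbabilityMeasure
  have key := hasSubgaussianMGF_of_mem_Icc_of_integral_eq_zero (μ := μ) (a := -1) (b := 1)
    (h.measurable n).aemeasurable (ae_of_all _ (h.mem_Icc n)) (h.integral_eq_zero n)
  have e : (‖(1 : ℝ) - (-1)‖₊ / 2) ^ 2 = 1 := by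
    ext
    norm_num
  rwa [e] at key

lemma integrable_of_continuous (h : IsLILSequence μ X) {f : ℝ → ℝ} (hf : Continuous f) (n : ℕ) :
    Integrable (fun ω => f (X n ω)) μ := by
  have := h.indep.isProbabilityMeasure
  obtain ⟨C, hC⟩ := (isCompact_Icc (a := (-1 : ℝ)) (b := 1)).exists_bound_of_continuousOn
    hf.continuousOn
  exact Integrable.of_bound (hf.measurable.comp (h.measurable n)).aestronglyMeasurable C
    (ae_of_all _ fun ω => hC _ (h.mem_Icc n ω))

lemma exp_le_mgf (h : IsLILSequence μ X) (n : ℕ) {t : ℝ} (ht : |t| ≤ 1) :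
    exp (t ^ 2 / 16) ≤ mgf (X n) μ t := by
  have := h.indep.isProbabilityMeasure
  have hpt : ∀ ω, 1 + t * X n ω + t ^ 2 / 4 * X n ω ^ 2 ≤ exp (t * X n ω) := by
    intro ω
    have hx : |t * X n ω| ≤ 1 := by
      rw [abs_mul]
      exact mul_le_one₀ ht (abs_nonneg _) (abs_le.2 (h.mem_Icc n ω))
    have hb := Real.exp_bound hx (n := 3) (by norm_num)
    have hc : |t * X n ω| ^ 3 ≤ (t * X n ω) ^ 2 := by
      rw [← sq_abs (t * X n ω)]
      exact pow_le_pow_of_le_one (abs_nonneg _) hx (by norm_num)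
    rw [abs_mul] at hc
    simp [Finset.sum_range_succ, Nat.factorial] at hb
    have := (abs_le.1 hb).1
    nlinarith [sq_nonneg (t * X n ω)]
  have hi1 : Integrable (fun ω => t * X n ω) μ :=
    h.integrable_of_continuous (f := fun x => t * x) (by fun_prop) n
  have hi2 : Integrable (fun ω => t ^ 2 / 4 * X n ω ^ 2) μ :=
    h.integrable_of_continuous (f := fun x => t ^ 2 / 4 * x ^ 2) (by fun_prop) n
  have hi3 : Integrable (fun ω => exp (t * X n ω)) μ :=
    h.integrable_of_continuous (f := fun x => exp (t * x)) (by fun_prop) n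
  have hi4 : Integrable (fun ω => 1 + t * X n ω) μ := (integrable_const (1 : ℝ)).add hi1
  have hle := integral_mono (hi4.add hi2) hi3 hpt
  have hcomp : ∫ ω, (1 + t * X n ω + t ^ 2 / 4 * X n ω ^ 2) ∂μ
      = 1 + t ^ 2 / 4 * ∫ ω, X n ω ^ 2 ∂μ := by
    rw [integral_add hi4 hi2,
      integral_add (integrable_const (1 : ℝ)) hi1, integral_const_mul, integral_const_mul,
      h.integral_eq_zero]
    simp
  have h1 : 1 + t ^ 2 / 8 ≤ mgf (X n) μ t := by
    refine le_trans ?_ hle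
    refine le_trans ?_ (le_of_eq hcomp.symm)
    nlinarith [h.le_integral_sq n, sq_nonneg t]
  refine le_trans ?_ h1
  have ht2 : t ^ 2 ≤ 1 := by rw [← sq_abs]; nlinarith [abs_nonneg t]
  have hb := Real.abs_exp_sub_one_sub_id_le (x := t ^ 2 / 16)
    (by rw [abs_of_nonneg (by positivity)]; linarith)
  have := (abs_le.1 hb).2
  nlinarith [sq_nonneg t]

lemma mgf_sum_le (h : IsLILSequence μ X) (s : Finset ℕ) (t : ℝ) :
    mgf (fun ω => ∑ i ∈ s, X i ω) μ t ≤ exp (s.card * t ^ 2 / 2) := by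
  have := (HasSubgaussianMGF.sum_of_iIndepFun h.indep (s := s) (c := fun _ => 1)
    (fun i _ => h.hasSubgaussianMGF i)).mgf_le t
  simpa using this

lemma le_mgf_sum (h : IsLILSequence μ X) (s : Finset ℕ) {t : ℝ} (ht : |t| ≤ 1) :
    exp (s.card * t ^ 2 / 16) ≤ mgf (fun ω => ∑ i ∈ s, X i ω) μ t := by
  have e : (fun ω => ∑ i ∈ s, X i ω) = ∑ i ∈ s, X i := by ext; simp
  rw [e, h.indep.mgf_sum h.measurable]
  calc exp (s.card * t ^ 2 / 16) = ∏ _i ∈ s, exp (t ^ 2 / 16) := by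
        rw [Finset.prod_const, ← Real.exp_nat_mul]; ring_nf
    _ ≤ _ := Finset.prod_le_prod (fun _ _ => (exp_pos _).le) fun i _ => h.exp_le_mgf i ht

lemma integrable_exp_sum (h : IsLILSequence μ X) (s : Finset ℕ) (t : ℝ) :
    Integrable (fun ω => exp (t * ∑ i ∈ s, X i ω)) μ :=
  (HasSubgaussianMGF.sum_of_iIndepFun h.indep (s := s) (c := fun _ => 1)
    (fun i _ => h.hasSubgaussianMGF i)).integrable_exp_mul t

/-- A lower tail bound obtained from the Paley-Zygmund inequality applied to `exp (t * S)`. -/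
lemma le_measureReal_sum (h : IsLILSequence μ X) (s : Finset ℕ) {t : ℝ} (ht0 : 0 < t)
    (ht : t ≤ 1) :
    exp (-(2 * s.card * t ^ 2)) / 4 ≤
      μ.real {ω | s.card * t / 16 - log 2 / t ≤ ∑ i ∈ s, X i ω} := by
  have := h.indep.isProbabilityMeasure
  set S : Ω → ℝ := fun ω => ∑ i ∈ s, X i ω with hS
  have hSm : Measurable S := Finset.measurable_sum _ fun i _ => h.measurable i
  set A : Set Ω := {ω | s.card * t / 16 - log 2 / t ≤ S ω} with hA
  have hAm : MeasurableSet A := measurableSet_le measurable_const hSm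
  set m : ℝ := mgf S μ t with hm
  set v : ℝ := mgf S μ (2 * t) with hv
  have hm1 : exp (s.card * t ^ 2 / 16) ≤ m :=
    h.le_mgf_sum s (abs_le.2 ⟨by linarith, ht⟩)
  have hm2 : 1 ≤ m := le_trans (Real.one_le_exp (by positivity)) hm1
  have hv2 : v ≤ exp (2 * s.card * t ^ 2) := by
    refine (h.mgf_sum_le s (2 * t)).trans (le_of_eq ?_)
    ring_nf
  have hint1 := h.integrable_exp_sum s t
  have hint2 := h.integrable_exp_sum s (2 * t)
  have hv0 : 0 < v := mgf_pos hint2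
  have hpt : ∀ ω, exp (t * S ω) ≤
      m / 2 + (m / (4 * v) * exp (2 * t * S ω) + A.indicator (fun _ => v / m) ω) := by
    intro ω
    by_cases hω : ω ∈ A
    · rw [indicator_of_mem hω]
      have e : exp (2 * t * S ω) = exp (t * S ω) ^ 2 := by
        rw [← Real.exp_nat_mul]; congr 1; push_cast; ring
      rw [e]
      have : m / (4 * v) * exp (t * S ω) ^ 2 + v / m - exp (t * S ω)
          = (m * exp (t * S ω) - 2 * v) ^ 2 / (4 * v * m) := by
        field_simp
        ring
      have h2 : 0 ≤ (m * exp (t * S ω) - 2 * v) ^ 2 / (4 * v * m) := by positivity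
      linarith
    · rw [indicator_of_notMem hω]
      have hlt : S ω < s.card * t / 16 - log 2 / t := not_le.1 hω
      have : t * S ω ≤ s.card * t ^ 2 / 16 - log 2 := by
        have := mul_le_mul_of_nonneg_left hlt.le ht0.le
        refine this.trans (le_of_eq ?_)
        field_simp
      have h3 : exp (t * S ω) ≤ m / 2 := by
        calc exp (t * S ω) ≤ exp (s.card * t ^ 2 / 16 - log 2) := exp_le_exp.2 this
          _ = exp (s.card * t ^ 2 / 16) / 2 := by rw [exp_sub, exp_log (by norm_num)]
          _ ≤ m / 2 := by linarith
      have : 0 ≤ m / (4 * v) * exp (2 * t * S ω) := by positivity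
      linarith
  have hind : Integrable (A.indicator (fun _ => v / m)) μ :=
    (integrable_const _).indicator hAm
  have hint3 : Integrable (fun ω => m / (4 * v) * exp (2 * t * S ω)) μ := hint2.const_mul _
  have hint4 : Integrable
      (fun ω => m / (4 * v) * exp (2 * t * S ω) + A.indicator (fun _ => v / m) ω) μ :=
    hint3.add hind
  have hle : m ≤ m / 2 + (m / (4 * v) * v + v / m * μ.real A) := by
    have e : ∫ ω, (m / 2 + (m / (4 * v) * exp (2 * t * S ω) + A.indicator (fun _ => v / m) ω)) ∂μ
        = m / 2 + (m / (4 * v) * v + v / m * μ.real A) := by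
      rw [integral_add (integrable_const _) hint4,
        integral_add hint3 hind, integral_const_mul, integral_indicator_const _ hAm]
      simp [hv, mgf, mul_comm]
    rw [← e]
    exact integral_mono hint1 ((integrable_const _).add hint4) hpt
  have e1 : m / (4 * v) * v = m / 4 := by field_simp
  rw [e1] at hle
  have h4 : m ^ 2 ≤ 4 * v * μ.real A := by
    have : m / 4 ≤ v / m * μ.real A := by linarith
    have := mul_le_mul_of_nonneg_left this (by positivity : 0 ≤ 4 * m)
    calc m ^ 2 = 4 * m * (m / 4) := by ring
      _ ≤ _ := this
      _ = _ := by field_simp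
  have h5 : 1 ≤ 4 * exp (2 * s.card * t ^ 2) * μ.real A := by
    have : v * μ.real A ≤ exp (2 * s.card * t ^ 2) * μ.real A := by gcongr
    nlinarith
  rw [exp_neg, div_le_iff₀ (by norm_num), inv_le_iff_one_le_mul₀ (exp_pos _)]
  linarith

lemma one_le_mgf (h : IsLILSequence μ X) (n : ℕ) (t : ℝ) : 1 ≤ mgf (X n) μ t := by
  have := h.indep.isProbabilityMeasure
  have hi : Integrable (fun ω => t * X n ω) μ :=
    h.integrable_of_continuous (f := fun x => t * x) (by fun_prop) n
  have hle : ∫ ω, (t * X n ω + 1) ∂μ ≤ ∫ ω, exp (t * X n ω) ∂μ :=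
    integral_mono (hi.add (integrable_const 1))
      (h.integrable_of_continuous (f := fun x => exp (t * x)) (by fun_prop) n)
      fun ω => add_one_le_exp _
  rw [integral_add hi (integrable_const 1), integral_const_mul, h.integral_eq_zero] at hle
  simpa [mgf] using hle

lemma submartingale_exp_sum (h : IsLILSequence μ X) (t : ℝ) :
    Submartingale (fun n ω => exp (t * ∑ i ∈ Finset.range (n + 1), X i ω))
      (Filtration.natural X fun n => (h.measurable n).stronglyMeasurable) μ := by
  have := h.indep.isProbabilityMeasure
  set 𝒢 := Filtration.natural X fun n => (h.measurable n).stronglyMeasurable with h𝒢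
  have hadp : StronglyAdapted 𝒢
      (fun n ω => exp (t * ∑ i ∈ Finset.range (n + 1), X i ω)) := by
    intro n
    refine Measurable.stronglyMeasurable ?_
    refine Measurable.exp (Measurable.const_mul (Finset.measurable_sum _ fun i hi => ?_) t)
    have h1 := Filtration.stronglyAdapted_natural
      (fun n => (h.measurable n).stronglyMeasurable) i
    exact (h1.mono (𝒢.mono (Nat.lt_succ_iff.1 (Finset.mem_range.1 hi)))).measurable
  have hexpInt : ∀ n, Integrable (fun ω => exp (t * ∑ i ∈ Finset.range (n + 1), X i ω)) μ :=
    fun n => h.integrable_exp_sum _ t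
  refine submartingale_nat hadp hexpInt fun n => ?_
  have hX : Integrable (fun ω => exp (t * X (n + 1) ω)) μ :=
    h.integrable_of_continuous (f := fun x => exp (t * x)) (by fun_prop) (n + 1)
  have hmul : (fun ω => exp (t * ∑ i ∈ Finset.range (n + 1 + 1), X i ω)) =
      (fun ω => exp (t * ∑ i ∈ Finset.range (n + 1), X i ω)) *
        fun ω => exp (t * X (n + 1) ω) := by
    ext ω
    rw [Finset.sum_range_succ, mul_add, exp_add]
    rfl
  have hpull := condExp_mul_of_stronglyMeasurable_left (m := 𝒢 n) (hadp n)
    (hmul ▸ hexpInt (n + 1)) hX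
  have hind := condExp_indep_eq (f := fun ω => exp (t * X (n + 1) ω))
    (h.measurable (n + 1)).comap_le (𝒢.le n)
    (Measurable.stronglyMeasurable
      (((comap_measurable (X (n + 1))).const_mul t).exp))
    (iIndepFun.indep_comap_natural_of_lt
      (fun n => (h.measurable n).stronglyMeasurable) h.indep (Nat.lt_succ_self n))
  rw [hmul]
  filter_upwards [hpull, hind] with ω h1 h2
  rw [h1, Pi.mul_apply, h2]
  exact le_mul_of_one_le_right (exp_pos _).le (h.one_le_mgf (n + 1) t)

/-- Doob's maximal inequality for the partial sums, in exponential form. -/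
lemma measure_exists_sum_ge_le (h : IsLILSequence μ X) (n : ℕ) {t x : ℝ} (ht : 0 ≤ t)
    (hx : 0 < x) :
    μ {ω | ∃ k ≤ n, x ≤ ∑ i ∈ Finset.range k, X i ω} ≤
      ENNReal.ofReal (exp (n * t ^ 2 / 2 - t * x)) := by
  have := h.indep.isProbabilityMeasure
  rcases n with _ | n
  · have : {ω | ∃ k ≤ 0, x ≤ ∑ i ∈ Finset.range k, X i ω} = ∅ := by
      ext ω
      simp [hx]
    rw [this]
    simp
  have hmax := maximal_ineq (h.submartingale_exp_sum t) (fun n ω => (exp_pos _).le)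
    (ε := (exp (t * x)).toNNReal) n
  have hε : (((exp (t * x)).toNNReal : NNReal) : ℝ) = exp (t * x) :=
    Real.coe_toNNReal _ (exp_pos _).le
  rw [hε] at hmax
  set B := {ω | exp (t * x) ≤ (Finset.range (n + 1)).sup' Finset.nonempty_range_add_one
    fun k => exp (t * ∑ i ∈ Finset.range (k + 1), X i ω)} with hB
  have hsub : {ω | ∃ k ≤ n + 1, x ≤ ∑ i ∈ Finset.range k, X i ω} ⊆ B := by
    rintro ω ⟨k, hk, hkx⟩
    rcases k with _ | k
    · simp at hkx; linarith
    · have hk' : k ∈ Finset.range (n + 1) := Finset.mem_range.2 (by omega)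
      exact (exp_le_exp.2 (mul_le_mul_of_nonneg_left hkx ht)).trans
        (Finset.le_sup' (fun k => exp (t * ∑ i ∈ Finset.range (k + 1), X i ω)) hk')
  have hle : ∫ ω in B, exp (t * ∑ i ∈ Finset.range (n + 1), X i ω) ∂μ ≤
      exp ((n + 1 : ℕ) * t ^ 2 / 2) := by
    refine (setIntegral_le_integral (h.integrable_exp_sum _ t)
      (ae_of_all _ fun ω => (exp_pos _).le)).trans ?_
    simpa [mgf] using h.mgf_sum_le (Finset.range (n + 1)) t
  have hmax' := hmax.trans (ENNReal.ofReal_le_ofReal hle)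
  refine (measure_mono hsub).trans ?_
  rw [exp_sub, ENNReal.ofReal_div_of_pos (exp_pos _)]
  rw [ENNReal.le_div_iff_mul_le (by left; simp [exp_pos]) (by left; simp), mul_comm]
  exact hmax'

lemma iIndepSet_block_sum (h : IsLILSequence μ X) {a : ℕ → ℕ} (ha : Monotone a) (c : ℕ → ℝ) :
    iIndepSet (fun j => {ω | c j ≤ ∑ i ∈ Finset.Ico (a j) (a (j + 1)), X i ω}) μ := by
  have := h.indep.isProbabilityMeasure
  have hmeas : ∀ (m : MeasurableSpace Ω) (j : ℕ),
      (∀ i, i ∈ Finset.Ico (a j) (a (j + 1)) → Measurable[m] (X i)) →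
      MeasurableSet[m] {ω | c j ≤ ∑ i ∈ Finset.Ico (a j) (a (j + 1)), X i ω} := by
    intro m j hj
    exact measurableSet_le measurable_const (Finset.measurable_sum _ hj)
  rw [iIndepSet_iff_meas_biInter fun j => hmeas _ j fun i _ => h.measurable i]
  intro s
  induction s using Finset.induction_on_max with
  | empty => simp
  | insert b s hb ih =>
    have hbs : b ∉ s := fun hmem => lt_irrefl _ (hb b hmem)
    rw [Finset.set_biInter_insert, Finset.prod_insert hbs, ← ih]
    have hI : Indep (⨆ k ∈ Ici (a b), MeasurableSpace.comap (X k) inferInstance)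
        (⨆ k ∈ Iio (a b), MeasurableSpace.comap (X k) inferInstance) μ :=
      indep_iSup_of_disjoint (fun k => (h.measurable k).comap_le) h.indep
        (Set.disjoint_left.2 fun x hx hx' =>
          (lt_irrefl _ (lt_of_le_of_lt (mem_Ici.1 hx) (mem_Iio.1 hx'))).elim)
    have hle : ∀ (T : Set ℕ) (i : ℕ), i ∈ T →
        Measurable[⨆ k ∈ T, MeasurableSpace.comap (X k) inferInstance] (X i) := fun T i hi =>
      (comap_measurable (X i)).mono
        (le_iSup₂ (f := fun k (_ : k ∈ T) => MeasurableSpace.comap (X k) inferInstance) i hi)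
        le_rfl
    refine (Indep_iff _ _ μ).1 hI _ _ (hmeas _ b fun i hi => hle _ i (Finset.mem_Ico.1 hi).1) ?_
    refine Finset.measurableSet_biInter _ fun j hj => hmeas _ j fun i hi => hle _ i ?_
    exact (Finset.mem_Ico.1 hi).2.trans_le (ha (hb j hj))

lemma ae_eventually_sum_lt_two_pow (h : IsLILSequence μ X) :
    ∀ᵐ ω ∂μ, ∀ᶠ j : ℕ in atTop, ∀ k ≤ 2 ^ j,
      ∑ i ∈ Finset.range k, X i ω < 2 * √(2 ^ j * log j) := by
  have hbound : ∀ j : ℕ, μ {ω | ∃ k ≤ 2 ^ (j + 2), 2 * √(2 ^ (j + 2) * log (j + 2 : ℕ)) ≤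
      ∑ i ∈ Finset.range k, X i ω} ≤ ENNReal.ofReal (1 / ((j + 2 : ℕ) : ℝ) ^ 2) := by
    intro j
    set M : ℝ := 2 ^ (j + 2) with hM
    set L : ℝ := log (j + 2 : ℕ) with hL
    have hj : (1 : ℝ) < (j + 2 : ℕ) := by push_cast; linarith [(j.cast_nonneg : (0 : ℝ) ≤ j)]
    have hL0 : 0 < L := log_pos hj
    have hM0 : 0 < M := by positivity
    refine (h.measure_exists_sum_ge_le (2 ^ (j + 2)) (t := 2 * √(L / M)) (by positivity)
      (by positivity)).trans (le_of_eq ?_)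
    congr 1
    have e1 : √(L / M) * √(M * L) = L := by
      rw [← Real.sqrt_mul (by positivity), show L / M * (M * L) = L ^ 2 by field_simp,
        Real.sqrt_sq hL0.le]
    have e2 : √(L / M) ^ 2 = L / M := Real.sq_sqrt (by positivity)
    have e3 : ((2 ^ (j + 2) : ℕ) : ℝ) * (2 * √(L / M)) ^ 2 / 2 - 2 * √(L / M) * (2 * √(M * L))
        = -(2 * L) := by
      have : 2 * √(L / M) * (2 * √(M * L)) = 4 * L := by
        rw [mul_mul_mul_comm, e1]
        norm_num
      rw [this, mul_pow, e2]
      push_cast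
      rw [← hM]
      field_simp
      ring
    rw [e3, exp_neg, one_div, hL, show (2 : ℝ) * log (j + 2 : ℕ) = (2 : ℕ) * log (j + 2 : ℕ) by
      norm_num, Real.exp_nat_mul, exp_log (by linarith)]
  have hsum : ∑' j : ℕ, μ {ω | ∃ k ≤ 2 ^ (j + 2), 2 * √(2 ^ (j + 2) * log (j + 2 : ℕ)) ≤
      ∑ i ∈ Finset.range k, X i ω} ≠ ⊤ := by
    refine ne_top_of_le_ne_top ?_ (ENNReal.tsum_le_tsum hbound)
    exact ((summable_nat_add_iff 2).2
      (Real.summable_one_div_nat_pow.2 one_lt_two)).tsum_ofReal_ne_top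
  filter_upwards [ae_eventually_notMem hsum] with ω hω
  obtain ⟨J, hJ⟩ := eventually_atTop.1 hω
  refine eventually_atTop.2 ⟨J + 2, fun j hj k hk => ?_⟩
  have := hJ (j - 2) (by omega)
  simp only [not_exists, not_and, not_le] at this
  rw [show j - 2 + 2 = j by omega] at this
  exact this k hk

/-- Upper half of the law of the iterated logarithm, up to a constant. -/
lemma ae_eventually_sum_le (h : IsLILSequence μ X) :
    ∀ᵐ ω ∂μ, ∀ᶠ n : ℕ in atTop,
      ∑ i ∈ Finset.range n, X i ω ≤ 4 * √(n * log (log n)) := by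
  filter_upwards [h.ae_eventually_sum_lt_two_pow] with ω hω
  obtain ⟨J, hJ⟩ := eventually_atTop.1 hω
  have hlog : ∀ᶠ n : ℕ in atTop, 3 ≤ log n :=
    (tendsto_log_atTop.comp tendsto_natCast_atTop_atTop).eventually_ge_atTop 3
  filter_upwards [hlog, eventually_ge_atTop (2 ^ J), eventually_ge_atTop 2] with n hn hnJ hn2
  set j := Nat.clog 2 n with hj
  have hJj : J ≤ j := by
    rw [hj, ← Nat.clog_pow 2 J one_lt_two]
    exact Nat.clog_mono_right 2 hnJ
  have hnj : n ≤ 2 ^ j := Nat.le_pow_clog one_lt_two n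
  have hjn : 2 ^ (j - 1) < n := Nat.pow_pred_clog_lt_self one_lt_two (by omega)
  have hj1 : 1 ≤ j := Nat.clog_pos one_lt_two (by omega)
  have hn0 : (0 : ℝ) < n := by positivity
  have h1 : (2 : ℝ) ^ j ≤ 2 * n := by
    have : (2 : ℝ) ^ (j - 1) < n := by exact_mod_cast hjn
    calc (2 : ℝ) ^ j = 2 * 2 ^ (j - 1) := by rw [← pow_succ']; congr 1; omega
      _ ≤ 2 * n := by linarith
  have h2 : (j : ℝ) ≤ log n ^ 2 := by
    have : j * log 2 ≤ log 2 + log n := by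
      rw [← Real.log_pow, ← Real.log_mul (by norm_num) hn0.ne']
      exact Real.log_le_log (by positivity) h1
    nlinarith [Real.log_two_gt_d9, Real.log_two_lt_d9, (j.cast_nonneg : (0 : ℝ) ≤ j)]
  have h3 : log j ≤ 2 * log (log n) := by
    have := Real.log_le_log (by exact_mod_cast hj1) h2
    rwa [Real.log_pow] at this
  have h4 := hJ j hJj n hnj
  refine h4.le.trans ?_
  have h5 : √(2 ^ j * log j) ≤ √(2 ^ 2 * (n * log (log n))) := by
    refine Real.sqrt_le_sqrt ?_
    have : 0 ≤ log (j : ℝ) := Real.log_natCast_nonneg j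
    calc (2 : ℝ) ^ j * log j ≤ 2 * n * (2 * log (log n)) := by gcongr
      _ = _ := by ring
  rw [Real.sqrt_mul (x := 2 ^ 2) (by positivity), Real.sqrt_sq (by norm_num)] at h5
  linarith

lemma ae_frequently_block_sum_ge (h : IsLILSequence μ X) :
    ∀ᵐ ω ∂μ, ∃ᶠ j : ℕ in atTop,
      √(2 ^ (20 * (j + 1)) * log (j + 2)) / 32 - √(2 * 2 ^ (20 * (j + 1)) / log (j + 2)) ≤
        ∑ i ∈ Finset.Ico (2 ^ (20 * j)) (2 ^ (20 * (j + 1))), X i ω := by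
  have := h.indep.isProbabilityMeasure
  set a : ℕ → ℕ := fun j => 2 ^ (20 * j) with ha
  have hamono : Monotone a := fun i j hij => Nat.pow_le_pow_right (by norm_num) (by omega)
  set n : ℕ → ℕ := fun j => (Finset.Ico (a j) (a (j + 1))).card with hn
  set t : ℕ → ℝ := fun j => √(log (j + 2) / (2 * n j)) with ht
  set c : ℕ → ℝ := fun j => n j * t j / 16 - log 2 / t j with hc
  set s : ℕ → Set Ω := fun j => {ω | c j ≤ ∑ i ∈ Finset.Ico (a j) (a (j + 1)), X i ω} with hs
  have hnle : ∀ j, (n j : ℝ) ≤ 2 ^ (20 * (j + 1)) := by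
    intro j
    simp only [hn, Nat.card_Ico, ha]
    exact_mod_cast Nat.sub_le _ _
  have hnge : ∀ j, (2 : ℝ) ^ (20 * (j + 1)) / 2 ≤ n j := by
    intro j
    simp only [hn, Nat.card_Ico]
    rw [Nat.cast_sub (hamono (Nat.le_succ j))]
    simp only [ha]
    push_cast
    rw [show 20 * (j + 1) = 20 * j + 20 by ring, pow_add]
    have : (0 : ℝ) < 2 ^ (20 * j) := by positivity
    linarith
  have hnpos : ∀ j, (0 : ℝ) < n j := fun j => lt_of_lt_of_le (by positivity) (hnge j)
  have hLpos : ∀ j : ℕ, 0 < log ((j : ℝ) + 2) := fun j =>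
    log_pos (by linarith [(j.cast_nonneg : (0 : ℝ) ≤ j)])
  have htpos : ∀ j, 0 < t j := fun j =>
    Real.sqrt_pos.2 (div_pos (hLpos j) (mul_pos two_pos (hnpos j)))
  have htsq : ∀ j, t j ^ 2 = log (j + 2) / (2 * n j) := fun j =>
    Real.sq_sqrt (div_pos (hLpos j) (mul_pos two_pos (hnpos j))).le
  have htle : ∀ j, t j ≤ 1 := by
    intro j
    refine Real.sqrt_le_one.2 ?_
    rw [div_le_one (mul_pos two_pos (hnpos j))]
    have h1 : log ((j : ℝ) + 2) ≤ j + 2 := (Real.log_le_self (by positivity))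
    have h2 : (j : ℝ) + 2 ≤ 2 ^ (20 * (j + 1)) := by
      have : j + 2 ≤ 2 ^ (20 * (j + 1)) := by
        have := Nat.lt_two_pow_self (n := 20 * (j + 1))
        omega
      exact_mod_cast this
    linarith [hnge j]
  have hprob : ∀ j : ℕ, 1 / 4 * (1 / ((j + 2 : ℕ) : ℝ)) ≤ μ.real (s j) := by
    intro j
    refine le_trans (le_of_eq ?_)
      (h.le_measureReal_sum (Finset.Ico (a j) (a (j + 1))) (htpos j) (htle j))
    have : 2 * ((Finset.Ico (a j) (a (j + 1))).card : ℝ) * t j ^ 2 = log (j + 2) := by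
      rw [htsq]
      have := (hnpos j).ne'
      change 2 * (n j : ℝ) * _ = _
      field_simp
    rw [this, exp_neg, exp_log (by positivity)]
    push_cast
    ring
  have hsm : ∀ j, MeasurableSet (s j) := fun j =>
    measurableSet_le measurable_const (Finset.measurable_sum _ fun i _ => h.measurable i)
  have htop : ∑' j, μ (s j) = ⊤ := by
    by_contra hne
    have h1 := ENNReal.summable_toReal hne
    have h2 := Summable.of_nonneg_of_le (fun j => by positivity) hprob h1
    rw [summable_mul_left_iff (by norm_num)] at h2
    exact Real.not_summable_one_div_natCast
      ((summable_nat_add_iff (f := fun k : ℕ => 1 / (k : ℝ)) 2).1 h2)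
  have hone := measure_limsup_eq_one hsm (h.iIndepSet_block_sum hamono c) htop
  have hae : ∀ᵐ ω ∂μ, ω ∈ limsup s atTop :=
    (mem_ae_iff_prob_eq_one (MeasurableSet.measurableSet_limsup hsm)).2 hone
  filter_upwards [hae] with ω hω
  refine (mem_limsup_iff_frequently_mem.1 hω).mono fun j hj => le_trans ?_ (mem_ofPred_eq ▸ hj)
  have hM : (0 : ℝ) < 2 ^ (20 * (j + 1)) := by positivity
  have h1 : √(2 ^ (20 * (j + 1)) * log (j + 2)) / 2 ≤ n j * t j := by
    refine (sq_le_sq₀ (by positivity) (mul_pos (hnpos j) (htpos j)).le).1 ?_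
    rw [div_pow, Real.sq_sqrt (mul_pos hM (hLpos j)).le, mul_pow, htsq]
    have : (n j : ℝ) ^ 2 * (log (j + 2) / (2 * n j)) = n j * log (j + 2) / 2 := by
      have := (hnpos j).ne'
      field_simp
    rw [this]
    nlinarith [hnge j, hLpos j]
  have h2 : log 2 / t j ≤ √(2 * 2 ^ (20 * (j + 1)) / log (j + 2)) := by
    have e : √(2 * n j / log (j + 2)) = 1 / t j := by
      rw [ht, one_div, ← Real.sqrt_inv, inv_div]
    calc log 2 / t j ≤ 1 / t j := by
          have := htpos j
          gcongr
          linarith [Real.log_two_lt_d9]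
      _ = √(2 * n j / log (j + 2)) := e.symm
      _ ≤ _ := by
          refine Real.sqrt_le_sqrt ?_
          have := hLpos j
          gcongr
          exact hnle j
  simp only [hc]
  linarith

/-- Lower half of the law of the iterated logarithm, up to a constant. -/
lemma ae_frequently_le_sum (h : IsLILSequence μ X) :
    ∀ᵐ ω ∂μ, ∃ᶠ n : ℕ in atTop,
      √(n * log (log n)) / 100 ≤ ∑ i ∈ Finset.range n, X i ω := by
  filter_upwards [h.ae_frequently_block_sum_ge, h.neg.ae_eventually_sum_lt_two_pow] with ω h1 h2
  have h2' : ∀ᶠ j : ℕ in atTop, -∑ i ∈ Finset.range (2 ^ (20 * j)), X i ω <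
      2 * √(2 ^ (20 * j) * log (20 * j : ℕ)) := by
    have ht : Tendsto (fun j : ℕ => 20 * j) atTop atTop :=
      tendsto_id.const_mul_atTop' (by norm_num)
    filter_upwards [ht.eventually h2] with j hj
    simpa using hj _ le_rfl
  have hL : ∀ᶠ j : ℕ in atTop, 200 ≤ log ((j : ℝ) + 2) :=
    (tendsto_log_atTop.comp
      (tendsto_atTop_add_const_right _ 2 tendsto_natCast_atTop_atTop)).eventually_ge_atTop 200
  have hfreq := h1.and_eventually (h2'.and (hL.and (eventually_ge_atTop 16)))
  have htend : Tendsto (fun j : ℕ => 2 ^ (20 * (j + 1))) atTop atTop := by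
    refine (tendsto_pow_atTop_atTop_of_one_lt (r := 2) one_lt_two).comp ?_
    exact (tendsto_add_atTop_nat 1).const_mul_atTop' (by norm_num)
  refine htend.frequently (hfreq.mono ?_)
  rintro j ⟨hb, hpre, hLj, hj⟩
  set M : ℝ := 2 ^ (20 * (j + 1)) with hM
  set L : ℝ := log (j + 2) with hLdef
  have hM0 : 0 < M := by positivity
  have hjR : (16 : ℝ) ≤ j := by exact_mod_cast hj
  have hsplit : ∑ i ∈ Finset.range (2 ^ (20 * (j + 1))), X i ω =
      ∑ i ∈ Finset.range (2 ^ (20 * j)), X i ω +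
        ∑ i ∈ Finset.Ico (2 ^ (20 * j)) (2 ^ (20 * (j + 1))), X i ω :=
    (Finset.sum_range_add_sum_Ico _ (Nat.pow_le_pow_right (by norm_num) (by omega))).symm
  have e1 : √(2 * M / L) ≤ √(M * L) / 128 := by
    refine (Real.sqrt_le_left (by positivity)).2 ?_
    rw [div_pow, Real.sq_sqrt (by positivity), div_le_iff₀ (by positivity)]
    have : (2 : ℝ) * 128 ^ 2 ≤ L ^ 2 := by nlinarith
    calc 2 * M = M * (2 * 128 ^ 2) / 128 ^ 2 := by ring
      _ ≤ M * L ^ 2 / 128 ^ 2 := by gcongr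
      _ = _ := by ring
  have e2 : √(2 ^ (20 * j) * log (20 * j : ℕ)) ≤ √(M * L) / 512 := by
    refine (Real.sqrt_le_left (by positivity)).2 ?_
    rw [div_pow, Real.sq_sqrt (by positivity)]
    have hlog : log (20 * j : ℕ) ≤ 2 * L := by
      rw [hLdef, show (2 : ℝ) * log (j + 2) = (2 : ℕ) * log (j + 2) by norm_num, ← Real.log_pow]
      refine Real.log_le_log (by push_cast; positivity) ?_
      push_cast
      nlinarith
    have hMe : M = 2 ^ (20 * j) * 2 ^ 20 := by
      rw [hM, ← pow_add]
      ring_nf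
    rw [hMe]
    have : (0 : ℝ) < 2 ^ (20 * j) := by positivity
    calc (2 : ℝ) ^ (20 * j) * log (20 * j : ℕ) ≤ 2 ^ (20 * j) * (2 * L) := by gcongr
      _ ≤ 2 ^ (20 * j) * (2 ^ 20 / 512 ^ 2 * L) := by gcongr; norm_num
      _ = _ := by ring
  have e3 : √(((2 ^ (20 * (j + 1)) : ℕ) : ℝ) * log (log ((2 ^ (20 * (j + 1)) : ℕ) : ℝ))) ≤
      √(M * L) * (3 / 2) := by
    refine (Real.sqrt_le_left (by positivity)).2 ?_
    rw [mul_pow, Real.sq_sqrt (by positivity)]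
    push_cast
    rw [← hM]
    have hlog : log (log M) ≤ 2 * L := by
      rw [hLdef, show (2 : ℝ) * log (j + 2) = (2 : ℕ) * log (j + 2) by norm_num, ← Real.log_pow,
        hM, Real.log_pow]
      refine Real.log_le_log (by have := log_pos one_lt_two; positivity) ?_
      push_cast
      nlinarith [Real.log_two_lt_d9]
    nlinarith
  have hS : 0 ≤ √(M * L) := Real.sqrt_nonneg _
  rw [hsplit]
  linarith

end IsLILSequence


lemma volume_inter_Ico_div {N : ℕ} {B : Set ℝ}
    (hB : ∀ x, x + 1 / (N : ℝ) ∈ B ↔ x ∈ B) (k : ℕ) :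
    volume (B ∩ Ico ((k : ℝ) / N) ((k + 1) / N)) = volume (B ∩ Ico (0 : ℝ) (1 / N)) := by
  have hk : ∀ x, x + (k : ℝ) / N ∈ B ↔ x ∈ B := by
    intro x
    induction k with
    | zero => simp
    | succ k ih => rw [← ih, ← hB (x + k / N)]; push_cast; ring_nf
  rw [← measure_preimage_add_right volume ((k : ℝ) / N)]
  congr 1
  ext x
  simp only [mem_preimage, mem_inter_iff, hk, mem_Ico, add_div]
  constructor <;> rintro ⟨h1, h2, h3⟩ <;> refine ⟨h1, ?_, ?_⟩ <;> linarith

open Classical in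
lemma volume_inter_inter_Ico {N : ℕ} (hN : 0 < N) {A B : Set ℝ} (hBm : MeasurableSet B)
    (hA : ∀ x y, ⌊(N : ℝ) * x⌋ = ⌊(N : ℝ) * y⌋ → (x ∈ A ↔ y ∈ A))
    (hB : ∀ x, x + 1 / (N : ℝ) ∈ B ↔ x ∈ B) :
    volume (A ∩ B ∩ Ico (0 : ℝ) 1) =
      ((Finset.range N).filter (fun k : ℕ => (k : ℝ) / N ∈ A)).card *
        volume (B ∩ Ico (0 : ℝ) (1 / N)) := by
  have hN' : (0 : ℝ) < N := by exact_mod_cast hN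
  have hfl : ∀ (k : ℕ) (x : ℝ), x ∈ Ico ((k : ℝ) / N) ((k + 1) / N) ↔ ⌊(N : ℝ) * x⌋ = k := by
    intro k x
    rw [Int.floor_eq_iff, mem_Ico, div_le_iff₀ hN', lt_div_iff₀ hN', mul_comm x]
    simp
  have hmem : ∀ (k : ℕ) (x : ℝ), ⌊(N : ℝ) * x⌋ = k → (x ∈ A ↔ (k : ℝ) / N ∈ A) := by
    intro k x hx
    refine hA _ _ ?_
    rw [hx, mul_div_cancel₀ _ hN'.ne']
    simp
  have hset : A ∩ B ∩ Ico (0 : ℝ) 1 =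
      ⋃ k ∈ (Finset.range N).filter (fun k : ℕ => (k : ℝ) / N ∈ A),
        B ∩ Ico ((k : ℝ) / N) ((k + 1) / N) := by
    ext x
    simp only [mem_inter_iff, mem_iUnion, Finset.mem_filter, Finset.mem_range, hfl, exists_prop]
    constructor
    · rintro ⟨⟨h1, h2⟩, h3, h4⟩
      have h0 : 0 ≤ ⌊(N : ℝ) * x⌋ := Int.floor_nonneg.2 (by positivity)
      obtain ⟨k, hk⟩ := Int.eq_ofNat_of_zero_le h0
      refine ⟨k, ⟨?_, (hmem k x hk).1 h1⟩, h2, hk⟩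
      have : ⌊(N : ℝ) * x⌋ < (N : ℤ) := Int.floor_lt.2 (by push_cast; nlinarith)
      omega
    · rintro ⟨k, ⟨hkN, hkA⟩, h2, hk⟩
      refine ⟨⟨(hmem k x hk).2 hkA, h2⟩, ?_⟩
      rw [← hfl, mem_Ico] at hk
      have : ((k : ℝ) + 1) / N ≤ 1 := by
        rw [div_le_one hN']; exact_mod_cast hkN
      exact ⟨le_trans (by positivity) hk.1, by linarith [hk.2]⟩
  rw [hset, measure_biUnion_finset]
  · simp [volume_inter_Ico_div hB]
  · intro i _ j _ hij
    refine disjoint_left.2 fun x hx hy => hij ?_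
    have h1 := (hfl i x).1 hx.2
    have h2 := (hfl j x).1 hy.2
    exact_mod_cast h1.symm.trans h2
  · exact fun k _ => hBm.inter measurableSet_Ico

lemma volume_restrict_inter_eq_mul {N : ℕ} (hN : 0 < N) {A B : Set ℝ} (hAm : MeasurableSet A)
    (hBm : MeasurableSet B)
    (hA : ∀ x y, ⌊(N : ℝ) * x⌋ = ⌊(N : ℝ) * y⌋ → (x ∈ A ↔ y ∈ A))
    (hB : ∀ x, x + 1 / (N : ℝ) ∈ B ↔ x ∈ B) :
    volume.restrict (Ico (0 : ℝ) 1) (A ∩ B) =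
      volume.restrict (Ico (0 : ℝ) 1) A * volume.restrict (Ico (0 : ℝ) 1) B := by
  classical
  have hN' : (0 : ℝ) < N := by exact_mod_cast hN
  have e1 := volume_inter_inter_Ico hN hBm hA hB
  have e2 := volume_inter_inter_Ico hN (B := univ) .univ hA (by simp)
  have e3 := volume_inter_inter_Ico hN (A := univ) hBm (by simp) hB
  simp only [inter_univ, univ_inter, mem_univ, Finset.filter_true, Finset.card_range,
    volume_Ico, sub_zero] at e2 e3
  rw [Measure.restrict_apply (hAm.inter hBm), Measure.restrict_apply hAm,
    Measure.restrict_apply hBm, e1, e2, e3]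
  have : ENNReal.ofReal (1 / (N : ℝ)) * N = 1 := by
    rw [← ENNReal.ofReal_natCast, ← ENNReal.ofReal_mul (by positivity),
      one_div_mul_cancel hN'.ne', ENNReal.ofReal_one]
  rw [mul_assoc, ← mul_assoc _ (N : ENNReal), this, one_mul]

/-- The exponents of the lacunary series. -/
def gapExp (n : ℕ) : ℕ := 2 ^ 2 ^ (n + 1)

lemma gapExp_pos (n : ℕ) : 0 < gapExp n := by unfold gapExp; positivity

lemma gapExp_succ (n : ℕ) : gapExp (n + 1) = gapExp n ^ 2 := by
  rw [gapExp, gapExp, ← pow_mul, ← pow_succ]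

lemma gapExp_dvd {m n : ℕ} (h : m ≤ n) : gapExp m ∣ gapExp n :=
  pow_dvd_pow _ (Nat.pow_le_pow_right (by norm_num) (by omega))

lemma four_dvd_gapExp (n : ℕ) : 4 ∣ gapExp n := gapExp_dvd (Nat.zero_le n)

lemma two_pow_le_gapExp (n : ℕ) : 2 ^ n ≤ gapExp n :=
  Nat.pow_le_pow_right (by norm_num) ((Nat.lt_two_pow_self (n := n)).le.trans
    (Nat.pow_le_pow_right (by norm_num) (by omega)))

/-- `cos (2 * π * gapExp n * x)` with the phase rounded down to a multiple of
`2 * π / gapExp n`. -/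
noncomputable def roundedCos (n : ℕ) (x : ℝ) : ℝ :=
  cos (2 * π * (⌊(gapExp (n + 1) : ℝ) * x⌋ / gapExp n))

lemma measurable_roundedCos (n : ℕ) : Measurable (roundedCos n) := by
  unfold roundedCos
  have : Measurable fun x : ℝ => ((⌊(gapExp (n + 1) : ℝ) * x⌋ : ℤ) : ℝ) :=
    measurable_from_top.comp (Int.measurable_floor.comp (measurable_id.const_mul _))
  fun_prop

lemma roundedCos_add_div (n : ℕ) (j : ℤ) (x : ℝ) :
    roundedCos n (x + j / gapExp (n + 1)) =
      cos (2 * π * (⌊(gapExp (n + 1) : ℝ) * x⌋ / gapExp n) + 2 * π * (j / gapExp n)) := by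
  have h : (gapExp (n + 1) : ℝ) ≠ 0 := by exact_mod_cast (gapExp_pos _).ne'
  rw [roundedCos, mul_add, mul_div_cancel₀ _ h, Int.floor_add_intCast]
  push_cast
  ring_nf

lemma roundedCos_add_one_div (n : ℕ) (x : ℝ) :
    roundedCos n (x + 1 / gapExp n) = roundedCos n x := by
  have h : (gapExp n : ℝ) ≠ 0 := by exact_mod_cast (gapExp_pos _).ne'
  have := roundedCos_add_div n (gapExp n) x
  rw [gapExp_succ] at this
  push_cast at this
  rw [show (gapExp n : ℝ) / (gapExp n : ℝ) ^ 2 = 1 / gapExp n by field_simp,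
    div_self h, mul_one, cos_add_two_pi] at this
  rw [this, roundedCos, gapExp_succ]
  push_cast
  rfl

lemma roundedCos_add_two_inv (n : ℕ) (x : ℝ) :
    roundedCos n (x + 1 / (2 * gapExp n)) = -roundedCos n x := by
  obtain ⟨k, hk⟩ := four_dvd_gapExp n
  have hk0 : (k : ℝ) ≠ 0 := by
    have := gapExp_pos n
    norm_cast
    rintro rfl
    omega
  have hN : (gapExp n : ℝ) = 4 * k := by exact_mod_cast hk
  have := roundedCos_add_div n ((2 * k : ℕ) : ℤ) x
  rw [show ((((2 * k : ℕ) : ℤ) : ℝ) / gapExp (n + 1)) = 1 / (2 * gapExp n) by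
      rw [gapExp_succ]; push_cast; rw [hN]; field_simp; norm_num,
    show ((((2 * k : ℕ) : ℤ) : ℝ) / gapExp n) = 1 / 2 by
      push_cast; rw [hN]; field_simp; norm_num] at this
  rw [this, show 2 * π * (1 / 2) = π by ring, cos_add_pi]
  rfl

lemma roundedCos_add_four_inv_sq (n : ℕ) (x : ℝ) :
    roundedCos n (x + 1 / (4 * gapExp n)) ^ 2 = 1 - roundedCos n x ^ 2 := by
  obtain ⟨k, hk⟩ := four_dvd_gapExp n
  have hk0 : (k : ℝ) ≠ 0 := by
    have := gapExp_pos n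
    norm_cast
    rintro rfl
    omega
  have hN : (gapExp n : ℝ) = 4 * k := by exact_mod_cast hk
  have := roundedCos_add_div n ((k : ℕ) : ℤ) x
  rw [show ((((k : ℕ) : ℤ) : ℝ) / gapExp (n + 1)) = 1 / (4 * gapExp n) by
      rw [gapExp_succ]; push_cast; rw [hN]; field_simp,
    show ((((k : ℕ) : ℤ) : ℝ) / gapExp n) = 1 / 4 by
      push_cast; rw [hN]; field_simp] at this
  rw [this, show 2 * π * (1 / 4) = π / 2 by ring, cos_add_pi_div_two, neg_sq, sin_sq]
  rfl

lemma periodic_roundedCos (n : ℕ) : Function.Periodic (roundedCos n) 1 := by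
  have h : (gapExp n : ℝ) ≠ 0 := by exact_mod_cast (gapExp_pos _).ne'
  have h1 : Function.Periodic (roundedCos n) (1 / gapExp n) := roundedCos_add_one_div n
  have := h1.nat_mul (gapExp n)
  rwa [mul_one_div_cancel h] at this

lemma integral_restrict_Ico_eq (f : ℝ → ℝ) (hf : Function.Periodic f 1) (s : ℝ) :
    ∫ x, f (x + s) ∂(volume.restrict (Ico (0 : ℝ) 1)) =
      ∫ x, f x ∂(volume.restrict (Ico (0 : ℝ) 1)) := by
  rw [integral_Ico_eq_integral_Ioc, integral_Ico_eq_integral_Ioc,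
    ← intervalIntegral.integral_of_le zero_le_one, ← intervalIntegral.integral_of_le zero_le_one,
    intervalIntegral.integral_comp_add_right, zero_add, add_comm 1 s]
  simpa using hf.intervalIntegral_add_eq s 0

lemma roundedCos_mem_Icc (n : ℕ) (x : ℝ) : roundedCos n x ∈ Icc (-1 : ℝ) 1 :=
  ⟨neg_one_le_cos _, cos_le_one _⟩

instance isProbabilityMeasure_restrict_Ico :
    IsProbabilityMeasure (volume.restrict (Ico (0 : ℝ) 1)) := ⟨by simp⟩

open ProbabilityTheory in
lemma iIndepFun_roundedCos : iIndepFun roundedCos (volume.restrict (Ico (0 : ℝ) 1)) := by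
  rw [iIndepFun_iff_measure_inter_preimage_eq_mul]
  intro S sets
  induction S using Finset.induction_on_max with
  | empty => simp
  | insert b s hb ih =>
    intro hs
    have hbs : b ∉ s := fun h => lt_irrefl _ (hb b h)
    rw [Finset.set_biInter_insert, Finset.prod_insert hbs, inter_comm, mul_comm,
      ← ih fun i hi => hs i (Finset.mem_insert_of_mem hi)]
    refine volume_restrict_inter_eq_mul (gapExp_pos b) ?_ ?_ ?_ ?_
    · exact Finset.measurableSet_biInter _ fun i hi =>
        measurable_roundedCos i (hs i (Finset.mem_insert_of_mem hi))
    · exact measurable_roundedCos b (hs b (Finset.mem_insert_self _ _))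
    · intro x y hxy
      simp only [mem_iInter, mem_preimage]
      refine forall₂_congr fun i hi => ?_
      have : roundedCos i x = roundedCos i y := by
        obtain ⟨c, hc⟩ := gapExp_dvd (hb i hi : i + 1 ≤ b)
        have hc0 : c ≠ 0 := by
          rintro rfl
          exact (gapExp_pos b).ne' (by simpa using hc)
        have key : ∀ z : ℝ, ⌊(gapExp (i + 1) : ℝ) * z⌋ = ⌊(gapExp b : ℝ) * z⌋ / (c : ℤ) := by
          intro z
          rw [← Int.floor_div_natCast, hc]
          congr 1
          push_cast
          field_simp
        rw [roundedCos, roundedCos, key, key, hxy]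
      rw [this]
    · intro x
      simp only [mem_preimage, roundedCos_add_one_div]

lemma isLILSequence_roundedCos :
    IsLILSequence (volume.restrict (Ico (0 : ℝ) 1)) roundedCos where
  measurable := measurable_roundedCos
  indep := iIndepFun_roundedCos
  mem_Icc := roundedCos_mem_Icc
  integral_eq_zero n := by
    have h := integral_restrict_Ico_eq _ (periodic_roundedCos n) (1 / (2 * gapExp n))
    simp only [roundedCos_add_two_inv, integral_neg] at h
    linarith
  le_integral_sq n := by
    have h := integral_restrict_Ico_eq (fun x => roundedCos n x ^ 2)
      (fun x => by simp only [periodic_roundedCos n x]) (1 / (4 * gapExp n))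
    have hi : Integrable (fun x => roundedCos n x ^ 2) (volume.restrict (Ico (0 : ℝ) 1)) := by
      refine Integrable.of_bound ((measurable_roundedCos n).pow_const 2).aestronglyMeasurable 1
        (ae_of_all _ fun x => ?_)
      rw [norm_pow]
      exact pow_le_one₀ (norm_nonneg _) (abs_le.2 (roundedCos_mem_Icc n x))
    simp only [roundedCos_add_four_inv_sq] at h
    rw [integral_sub (integrable_const _) hi] at h
    simp at h
    simp
    linarith

lemma abs_roundedCos_sub_le (n : ℕ) (x : ℝ) :
    |roundedCos n x - cos (2 * π * (gapExp n * x))| ≤ 2 * π * (1 / 2) ^ n := by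
  have hN : (0 : ℝ) < gapExp n := by exact_mod_cast gapExp_pos _
  have hN2 : (2 : ℝ) ^ n ≤ gapExp n := by exact_mod_cast two_pow_le_gapExp n
  refine (abs_cos_sub_cos_le _ _).trans ?_
  rw [← mul_sub, abs_mul, abs_of_pos two_pi_pos]
  gcongr
  have h1 := Int.floor_le ((gapExp (n + 1) : ℝ) * x)
  have h2 := Int.lt_floor_add_one ((gapExp (n + 1) : ℝ) * x)
  have e : (gapExp n : ℝ) * x = gapExp (n + 1) * x / gapExp n := by
    rw [gapExp_succ]; push_cast; field_simp
  rw [e, ← sub_div, abs_div, abs_of_pos hN, one_div, inv_pow, div_eq_mul_inv]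
  have : |(⌊(gapExp (n + 1) : ℝ) * x⌋ : ℝ) - gapExp (n + 1) * x| ≤ 1 := by
    rw [abs_le]; constructor <;> linarith
  calc _ ≤ 1 * ((2 : ℝ) ^ n)⁻¹ := by gcongr
    _ = _ := one_mul _

lemma abs_sum_roundedCos_sub_le (m : ℕ) (x : ℝ) :
    |∑ n ∈ Finset.range m, roundedCos n x -
      ∑ n ∈ Finset.range m, cos (2 * π * (gapExp n * x))| ≤ 4 * π := by
  rw [← Finset.sum_sub_distrib]
  calc _ ≤ ∑ n ∈ Finset.range m, |roundedCos n x - cos (2 * π * (gapExp n * x))| :=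
        Finset.abs_sum_le_sum_abs _ _
    _ ≤ ∑ n ∈ Finset.range m, 2 * π * (1 / 2 : ℝ) ^ n :=
        Finset.sum_le_sum fun n _ => abs_roundedCos_sub_le n x
    _ = 2 * π * ∑ n ∈ Finset.range m, (1 / 2 : ℝ) ^ n := by rw [Finset.mul_sum]
    _ ≤ 2 * π * 2 := by
        gcongr
        calc _ ≤ ∑' n : ℕ, (1 / 2 : ℝ) ^ n :=
              summable_geometric_two.sum_le_tsum _ fun _ _ => by positivity
          _ = 2 := tsum_geometric_two
    _ = _ := by ring

lemma ae_restrict_Ioc_of_ae_restrict_Ico {p : ℝ → Prop}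
    (h : ∀ᵐ x ∂(volume.restrict (Ico (0 : ℝ) 1)), p x) :
    ∀ᵐ φ ∂(volume.restrict (Ioc (-π) π)), p ((φ + π) / (2 * π)) := by
  rw [ae_restrict_iff' measurableSet_Ico] at h
  rw [ae_restrict_iff' measurableSet_Ioc]
  have hq : ∀ᵐ x : ℝ, x ≠ 1 := by simp [ae_iff]
  have hqmp : Measure.QuasiMeasurePreserving (fun φ : ℝ => (φ + π) / (2 * π)) volume volume := by
    refine ⟨by fun_prop, Measure.AbsolutelyContinuous.mk fun s hs h0 => ?_⟩
    rw [Measure.map_apply (by fun_prop) hs]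
    have : (fun φ : ℝ => (φ + π) / (2 * π)) ⁻¹' s =
        (fun φ => φ + π) ⁻¹' ((fun x => (2 * π)⁻¹ * x) ⁻¹' s) := by
      ext x; simp [div_eq_inv_mul]
    rw [this, measure_preimage_add_right,
      Real.volume_preimage_mul_left (inv_ne_zero two_pi_pos.ne'), h0, mul_zero]
  filter_upwards [hqmp.ae h, hqmp.ae hq] with φ h1 h2 h3
  refine h1 ⟨by have := h3.1; have := pi_pos; apply div_nonneg <;> linarith, lt_of_le_of_ne ?_ h2⟩
  rw [div_le_one two_pi_pos]
  linarith [h3.2]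

/-- The radial weight `1 / ((1 - r) * log (1 / (1 - r)) ^ 2)`. -/
noncomputable def radialWeight (r : ℝ) : ℝ := 1 / ((1 - r) * log (1 / (1 - r)) ^ 2)

lemma log_two_ge_half : 1 / 2 ≤ log 2 := by linarith [log_two_gt_d9]

lemma log_le_log_one_div {r x : ℝ} (hr : r < 1) (hx : 0 < x) (h : x * (1 - r) ≤ 1) :
    log x ≤ log (1 / (1 - r)) :=
  log_le_log hx ((le_div_iff₀ (by linarith)).2 h)

lemma log_one_div_pos {r : ℝ} (h1 : 1 / 2 ≤ r) (h2 : r < 1) : 0 < log (1 / (1 - r)) :=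
  (by linarith [log_two_ge_half] : (0 : ℝ) < log 2).trans_le
    (log_le_log_one_div h2 two_pos (by linarith))

lemma radialWeight_nonneg {r : ℝ} (h2 : r < 1) : 0 ≤ radialWeight r := by
  have : 0 < 1 - r := by linarith
  unfold radialWeight
  positivity

lemma radialWeight_le {r c : ℝ} (h2 : r < 1) (hc : 0 < c) (h : c ≤ log (1 / (1 - r))) :
    radialWeight r ≤ 1 / ((1 - r) * c ^ 2) := by
  have : 0 < 1 - r := by linarith
  unfold radialWeight
  gcongr

lemma hasDerivAt_neg_inv_log {r : ℝ} (h1 : 1 / 2 ≤ r) (h2 : r < 1) :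
    HasDerivAt (fun r => -(log (1 / (1 - r)))⁻¹) (radialWeight r) r := by
  have h0 : (1 - r) ≠ 0 := by linarith
  have hl := (log_one_div_pos h1 h2).ne'
  have e : (fun r : ℝ => log (1 / (1 - r))) = fun r => -log (1 - r) := by
    ext r; rw [one_div, log_inv]
  have d : HasDerivAt (fun r : ℝ => log (1 / (1 - r))) (1 / (1 - r)) r := by
    rw [e]
    exact (((hasDerivAt_id r).const_sub 1).log h0).neg.congr_deriv (by simp [neg_div])
  refine (d.inv hl).neg.congr_deriv ?_
  unfold radialWeight
  field_simp

lemma continuousOn_radialWeight {a b : ℝ} (h1 : 1 / 2 ≤ a) (h2 : b < 1) :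
    ContinuousOn radialWeight (Icc a b) := by
  intro r hr
  have h0 : (1 - r) ≠ 0 := by linarith [hr.2]
  have hl := (log_one_div_pos (h1.trans hr.1) (hr.2.trans_lt h2)).ne'
  unfold radialWeight
  refine ContinuousAt.continuousWithinAt ?_
  have : 1 / (1 - r) ≠ 0 := one_div_ne_zero h0
  fun_prop (disch := first | assumption | positivity)

lemma integral_radialWeight {a b : ℝ} (h1 : 1 / 2 ≤ a) (hab : a ≤ b) (h2 : b < 1) :
    ∫ r in a..b, radialWeight r = (log (1 / (1 - a)))⁻¹ - (log (1 / (1 - b)))⁻¹ := by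
  rw [intervalIntegral.integral_eq_sub_of_hasDerivAt (f := fun r => -(log (1 / (1 - r)))⁻¹)]
  · ring
  · intro r hr
    rw [uIcc_of_le hab] at hr
    exact hasDerivAt_neg_inv_log (h1.trans hr.1) (hr.2.trans_lt h2)
  · exact (uIcc_of_le hab ▸ continuousOn_radialWeight h1 h2).intervalIntegrable

/-- A kernel of mass at most one dominating the error made when `r ^ N` is replaced by the
indicator of `[1 - 1 / N, 1)`. -/
noncomputable def errorKernel (N r : ℝ) : ℝ := N / (1 + N * (1 - r)) ^ 2

lemma hasDerivAt_inv_one_add {N r : ℝ} (hN : 0 < N) (hr : r < 1) :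
    HasDerivAt (fun r => (1 + N * (1 - r))⁻¹) (errorKernel N r) r := by
  have h0 : 1 + N * (1 - r) ≠ 0 := by
    have : 0 < N * (1 - r) := mul_pos hN (by linarith)
    linarith
  refine ((((hasDerivAt_id r).const_sub 1).const_mul N).const_add 1).inv h0 |>.congr_deriv ?_
  unfold errorKernel
  simp

lemma intervalIntegrable_errorKernel {N a b : ℝ} (hN : 0 < N) (hab : a ≤ b) (hb : b < 1) :
    IntervalIntegrable (errorKernel N) volume a b := by
  refine ContinuousOn.intervalIntegrable ?_
  rw [uIcc_of_le hab]
  intro r hr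
  have h0 : 1 + N * (1 - r) ≠ 0 := by
    have : 0 < N * (1 - r) := mul_pos hN (by linarith [hr.2])
    linarith
  unfold errorKernel
  refine ContinuousAt.continuousWithinAt ?_
  fun_prop (disch := positivity)

lemma norm_integral_le_errorKernel {N a b c : ℝ} {f : ℝ → ℝ} (hN : 0 < N) (hab : a ≤ b)
    (hb : b < 1) (hf : ∀ r, a ≤ r → r ≤ b → |f r| ≤ c * errorKernel N r) :
    |∫ r in a..b, f r| ≤ c * ((1 + N * (1 - b))⁻¹ - (1 + N * (1 - a))⁻¹) := by
  have hi := intervalIntegrable_errorKernel hN hab hb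
  have := intervalIntegral.norm_integral_le_of_norm_le hab (f := f)
    (ae_of_all _ fun t ht => hf t ht.1.le ht.2) (hi.const_mul c)
  rwa [intervalIntegral.integral_const_mul, norm_eq_abs,
    intervalIntegral.integral_eq_sub_of_hasDerivAt
      (fun r hr => hasDerivAt_inv_one_add hN
        ((uIcc_of_le hab ▸ hr : r ∈ Icc a b).2.trans_lt hb)) hi] at this

lemma log_gapExp (n : ℕ) : log (gapExp n) = 2 ^ (n + 1) * log 2 := by
  simp [gapExp]

lemma four_pow_le_two_pow_two_pow (n : ℕ) : 4 ^ n ≤ 2 ^ 2 ^ n := by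
  rw [show 4 = 2 ^ 2 by norm_num, ← pow_mul]
  refine Nat.pow_le_pow_right (by norm_num) ?_
  cases n with
  | zero => simp
  | succ n =>
    have := (Nat.lt_two_pow_self (n := n))
    rw [pow_succ]
    omega

lemma one_sub_pow_mul_radialWeight_le (n : ℕ) {r : ℝ} (h2 : r < 1)
    (h3 : gapExp n * (1 - r) ≤ 1) :
    (1 - r ^ gapExp n) * radialWeight r ≤ 32 / 4 ^ n * errorKernel (gapExp n) r := by
  have hN : (0 : ℝ) < gapExp n := by exact_mod_cast gapExp_pos _
  set N : ℝ := (gapExp n : ℝ) with hNdef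
  have hs : 0 < 1 - r := by linarith
  have hl : 2 ^ n ≤ log (1 / (1 - r)) := by
    refine le_trans ?_ (log_le_log_one_div h2 hN h3)
    rw [log_gapExp, pow_succ]
    have := log_two_ge_half
    have h4 : (0 : ℝ) < 2 ^ n := by positivity
    nlinarith
  have hb : 1 - N * (1 - r) ≤ r ^ gapExp n := by
    have := one_add_mul_le_pow (a := -(1 - r)) (by
      have : (4 : ℝ) ≤ N := by rw [hNdef]; exact_mod_cast Nat.le_of_dvd (gapExp_pos n) (four_dvd_gapExp n)
      nlinarith) (gapExp n)
    rw [show 1 + -(1 - r) = r by ring] at this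
    linarith
  have hw := radialWeight_le h2 (by positivity) hl
  calc _ ≤ (N * (1 - r)) * (1 / ((1 - r) * (2 ^ n) ^ 2)) :=
        mul_le_mul (by linarith) hw (radialWeight_nonneg h2) (by positivity)
    _ = N / 4 ^ n := by
        rw [← pow_mul, mul_comm n 2, pow_mul]; norm_num; field_simp
    _ = 32 / 4 ^ n * (N / 32) := by field_simp
    _ ≤ 32 / 4 ^ n * errorKernel N r := by
        unfold errorKernel
        have : 0 < N * (1 - r) := by positivity
        gcongr
        nlinarith

lemma pow_mul_radialWeight_le (n : ℕ) {r : ℝ} (h1 : 1 / 2 ≤ r) (h2 : r < 1)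
    (h3 : 1 ≤ gapExp n * (1 - r)) :
    r ^ gapExp n * radialWeight r ≤ 32 / 4 ^ n * errorKernel (gapExp n) r := by
  have hN : (0 : ℝ) < gapExp n := by exact_mod_cast gapExp_pos _
  have hs : 0 < 1 - r := by linarith
  have hr : 0 < r := by linarith
  have he : r ^ gapExp n ≤ exp (-(gapExp n * (1 - r))) := by
    have : r ≤ exp (-(1 - r)) := by have := add_one_le_exp (-(1 - r)); linarith
    calc _ ≤ exp (-(1 - r)) ^ gapExp n := pow_le_pow_left₀ hr.le this _
      _ = _ := by rw [← exp_nat_mul]; ring_nf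
  set M : ℝ := 2 ^ 2 ^ n with hM
  have hM0 : 0 < M := by positivity
  have hM4 : 4 ^ n ≤ M := by rw [hM]; exact_mod_cast four_pow_le_two_pow_two_pow n
  have hNM : (gapExp n : ℝ) = M ^ 2 := by
    rw [gapExp, hM, ← pow_mul, ← pow_succ]; norm_cast
  generalize (gapExp n : ℝ) = N at *
  set y := N * (1 - r) with hy
  have hy0 : 0 < y := by linarith
  have hK : N / (4 * y ^ 2) ≤ errorKernel N r := by
    unfold errorKernel
    rw [← hy]
    gcongr
    nlinarith
  have h4 : ((2 : ℝ) ^ n) ^ 2 = 4 ^ n := by rw [← pow_mul, mul_comm n 2, pow_mul]; norm_num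
  rcases le_or_gt y M with hyM | hyM
  · have hl : 2 ^ n / 2 ≤ log (1 / (1 - r)) := by
      refine le_trans ?_ (log_le_log_one_div h2 hM0 ?_)
      · rw [hM, log_pow]
        push_cast
        have := log_two_ge_half
        have h4 : (0 : ℝ) < 2 ^ n := by positivity
        nlinarith
      · rw [hy, hNM] at hyM
        nlinarith
    have hw := radialWeight_le h2 (by positivity) hl
    have hexp : exp (-y) ≤ 1 / y := by
      rw [exp_neg, ← one_div]
      exact one_div_le_one_div_of_le hy0 (by linarith [add_one_le_exp y])
    calc _ ≤ (1 / y) * (1 / ((1 - r) * (2 ^ n / 2) ^ 2)) :=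
          mul_le_mul (he.trans hexp) hw (radialWeight_nonneg h2) (by positivity)
      _ = 16 / 4 ^ n * (N / (4 * y ^ 2)) := by
          rw [div_pow, h4, hy]; field_simp; norm_num
      _ ≤ 32 / 4 ^ n * errorKernel N r := by gcongr; norm_num
  · have hl : 1 / 2 ≤ log (1 / (1 - r)) :=
      log_two_ge_half.trans (log_le_log_one_div h2 two_pos (by linarith))
    have hw := radialWeight_le h2 (by positivity) hl
    have hexp : exp (-y) ≤ 2 / y ^ 2 := by
      rw [exp_neg, ← one_div, div_le_div_iff₀ (exp_pos _) (by positivity)]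
      have := quadratic_le_exp_of_nonneg hy0.le
      nlinarith
    calc _ ≤ (2 / y ^ 2) * (1 / ((1 - r) * (1 / 2) ^ 2)) :=
          mul_le_mul (he.trans hexp) hw (radialWeight_nonneg h2) (by positivity)
      _ = 32 / y * (N / (4 * y ^ 2)) := by rw [hy]; field_simp; norm_num
      _ ≤ 32 / 4 ^ n * errorKernel N r := by gcongr; linarith

lemma intervalIntegrable_pow_mul_radialWeight (k : ℕ) {a b : ℝ} (h1 : 1 / 2 ≤ a) (hab : a ≤ b)
    (h2 : b < 1) : IntervalIntegrable (fun r => r ^ k * radialWeight r) volume a b := by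
  refine ContinuousOn.intervalIntegrable ?_
  rw [uIcc_of_le hab]
  exact (by fun_prop : Continuous fun r : ℝ => r ^ k).continuousOn.mul
    (continuousOn_radialWeight h1 h2)

lemma abs_integral_pow_mul_radialWeight_le (n : ℕ) {R : ℝ} (h1 : 1 / 2 ≤ R) (h2 : R < 1)
    (h3 : 1 ≤ gapExp n * (1 - R)) :
    |∫ r in (1 / 2 : ℝ)..R, r ^ gapExp n * radialWeight r| ≤ 32 / 4 ^ n := by
  have hN : (0 : ℝ) < gapExp n := by exact_mod_cast gapExp_pos _
  refine (norm_integral_le_errorKernel (c := 32 / 4 ^ n) hN h1 h2 ?_).trans ?_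
  · intro r hr hrR
    rw [abs_of_nonneg (mul_nonneg (by positivity) (radialWeight_nonneg (hrR.trans_lt h2)))]
    exact pow_mul_radialWeight_le n hr (hrR.trans_lt h2) (h3.trans (by gcongr))
  · refine mul_le_of_le_one_right (by positivity) ?_
    have h4 : (1 + gapExp n * (1 - R))⁻¹ ≤ 1 := inv_le_one_of_one_le₀ (by linarith)
    have h5 : 0 ≤ (1 + gapExp n * (1 - (1 / 2 : ℝ)))⁻¹ := by positivity
    linarith

lemma abs_integral_pow_mul_radialWeight_sub_le (n : ℕ) {R : ℝ} (h2 : R < 1)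
    (h3 : gapExp n * (1 - R) ≤ 1) :
    |(∫ r in (1 / 2 : ℝ)..R, r ^ gapExp n * radialWeight r) -
      ((2 ^ (n + 1) * log 2)⁻¹ - (log (1 / (1 - R)))⁻¹)| ≤ 32 / 4 ^ n := by
  have hN : (0 : ℝ) < gapExp n := by exact_mod_cast gapExp_pos _
  have hN4 : (4 : ℝ) ≤ gapExp n := by
    exact_mod_cast Nat.le_of_dvd (gapExp_pos n) (four_dvd_gapExp n)
  set ρ : ℝ := 1 - 1 / gapExp n with hρ
  have hρN : (gapExp n : ℝ) * (1 - ρ) = 1 := by rw [hρ]; field_simp; ring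
  have hρ1 : 1 / 2 ≤ ρ := by nlinarith
  have hρ2 : ρ < 1 := by nlinarith
  have hρR : ρ ≤ R := by nlinarith
  have hA := norm_integral_le_errorKernel (f := fun r => r ^ gapExp n * radialWeight r)
    (c := 32 / 4 ^ n) hN hρ1 hρ2 (fun r hr hrR => by
      rw [abs_of_nonneg (mul_nonneg (by positivity) (radialWeight_nonneg (hrR.trans_lt hρ2)))]
      exact pow_mul_radialWeight_le n hr (hrR.trans_lt hρ2) (by nlinarith))
  have hB := norm_integral_le_errorKernel
    (f := fun r => r ^ gapExp n * radialWeight r - radialWeight r)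
    (c := 32 / 4 ^ n) hN hρR h2 (fun r hr hrR => by
      have hr1 : r < 1 := hrR.trans_lt h2
      have : r ^ gapExp n ≤ 1 := pow_le_one₀ (by linarith) hr1.le
      have hw := radialWeight_nonneg hr1
      rw [abs_of_nonpos (by nlinarith)]
      have := one_sub_pow_mul_radialWeight_le n hr1 (by nlinarith)
      linarith)
  have hwi : IntervalIntegrable radialWeight volume ρ R := by
    simpa using intervalIntegrable_pow_mul_radialWeight 0 hρ1 hρR h2
  rw [intervalIntegral.integral_sub
    (intervalIntegrable_pow_mul_radialWeight _ hρ1 hρR h2) hwi,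
    integral_radialWeight hρ1 hρR h2,
    show 1 / (1 - ρ) = gapExp n by rw [div_eq_iff (by linarith)]; linarith, log_gapExp] at hB
  rw [← intervalIntegral.integral_add_adjacent_intervals
    (intervalIntegrable_pow_mul_radialWeight _ le_rfl hρ1 hρ2)
    (intervalIntegrable_pow_mul_radialWeight _ hρ1 hρR h2)]
  rw [add_sub_assoc]
  refine (abs_add_le _ _).trans ((add_le_add hA hB).trans ?_)
  rw [← mul_add]
  refine mul_le_of_le_one_right (by positivity) ?_
  have h4 : (1 + gapExp n * (1 - R))⁻¹ ≤ 1 :=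
    inv_le_one_of_one_le₀ (by nlinarith)
  have h5 : 0 ≤ (1 + gapExp n * (1 - (1 / 2 : ℝ)))⁻¹ := by positivity
  linarith

lemma summable_two_pow_mul_pow_gapExp {R : ℝ} (h0 : 0 ≤ R) (h1 : R < 1) :
    Summable fun n => (2 : ℝ) ^ (n + 1) * R ^ gapExp n := by
  have hs : Summable fun k : ℕ => (k : ℝ) ^ 1 * R ^ k :=
    summable_pow_mul_geometric_of_norm_lt_one 1 (by rwa [norm_eq_abs, abs_of_nonneg h0])
  have hinj : Function.Injective gapExp := by
    intro m n h
    have h1 := Nat.pow_right_injective le_rfl h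
    have h2 := Nat.pow_right_injective le_rfl h1
    omega
  refine (hs.comp_injective hinj).of_nonneg_of_le (fun n => by positivity) fun n => ?_
  simp only [Function.comp, pow_one]
  gcongr
  unfold gapExp
  have := (Nat.lt_two_pow_self (n := n + 1)).le
  exact_mod_cast Nat.pow_le_pow_right two_pos this

lemma hasSum_uEx {r : ℝ} (h0 : 0 ≤ r) (h1 : r < 1) (φ : ℝ) :
    HasSum (fun n => 2 ^ (n + 1) * r ^ gapExp n * cos (gapExp n * φ))
      (uEx (r * Complex.exp (Complex.I * φ))) := by
  have hre : ∀ n : ℕ, ((2 : ℂ) ^ (n + 1) * (r * Complex.exp (Complex.I * φ)) ^ gapExp n) =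
      ((2 ^ (n + 1) * r ^ gapExp n : ℝ) : ℂ) * Complex.exp ((gapExp n * φ : ℝ) * Complex.I) := by
    intro n
    rw [mul_pow, ← Complex.exp_nat_mul, ← mul_assoc]
    push_cast
    ring_nf
  have hs : Summable fun n : ℕ =>
      (2 : ℂ) ^ (n + 1) * (r * Complex.exp (Complex.I * φ)) ^ gapExp n := by
    refine Summable.of_norm ((summable_two_pow_mul_pow_gapExp h0 h1).congr fun n => ?_)
    rw [hre, norm_mul, Complex.norm_exp_ofReal_mul_I, mul_one, Complex.norm_real, norm_eq_abs,
      abs_of_nonneg (by positivity)]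
  refine (Complex.hasSum_re hs.hasSum).congr_fun fun n => ?_
  rw [hre, Complex.re_ofReal_mul, Complex.exp_ofReal_mul_I_re]

lemma hasSum_Iu {R : ℝ} (h1 : 1 / 2 ≤ R) (h2 : R < 1) (φ : ℝ) :
    HasSum (fun n => 2 ^ (n + 1) * cos (gapExp n * φ) *
      ∫ r in (1 / 2 : ℝ)..R, r ^ gapExp n * radialWeight r) (Iu uEx R φ) := by
  have hu : ∀ r ∈ uIoc (1 / 2 : ℝ) R, 1 / 2 < r ∧ r ≤ R := fun r hr => by
    rwa [uIoc_of_le h1] at hr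
  have hsum := summable_two_pow_mul_pow_gapExp (by linarith : (0 : ℝ) ≤ R) h2
  have key := intervalIntegral.hasSum_integral_of_dominated_convergence (μ := volume)
    (a := 1 / 2) (b := R)
    (F := fun n r => (2 ^ (n + 1) * cos (gapExp n * φ)) * (r ^ gapExp n * radialWeight r))
    (f := fun r => uEx (r * Complex.exp (Complex.I * φ)) / ((1 - r) * (log (1 / (1 - r))) ^ 2))
    (fun n _ => 2 ^ (n + 1) * R ^ gapExp n * (1 / ((1 - R) * (1 / 2) ^ 2)))
    (fun n => ((intervalIntegrable_pow_mul_radialWeight _ le_rfl h1 h2).const_mul _).def'.1)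
    (fun n => ae_of_all _ fun r hr => ?_)
    (ae_of_all _ fun r hr => hsum.mul_right _) intervalIntegrable_const
    (ae_of_all _ fun r hr => ?_)
  · simp only [intervalIntegral.integral_const_mul] at key
    exact key
  · obtain ⟨hr1, hr2⟩ := hu r hr
    have hr3 : r < 1 := hr2.trans_lt h2
    have hw0 := radialWeight_nonneg hr3
    have hw : radialWeight r ≤ 1 / ((1 - R) * (1 / 2) ^ 2) := by
      refine (radialWeight_le hr3 (c := 1 / 2) (by norm_num) (log_two_ge_half.trans
        (log_le_log_one_div hr3 two_pos (by linarith)))).trans ?_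
      have : 0 < 1 - R := by linarith
      gcongr
    rw [norm_eq_abs, abs_mul, abs_mul, abs_of_nonneg (by positivity : (0 : ℝ) ≤ 2 ^ (n + 1)),
      abs_of_nonneg (mul_nonneg (by positivity) hw0 : 0 ≤ r ^ gapExp n * radialWeight r),
      ← mul_assoc]
    gcongr
    calc _ ≤ (2 : ℝ) ^ (n + 1) * 1 := by gcongr; exact abs_cos_le_one _
      _ = _ := mul_one _
  · obtain ⟨hr1, hr2⟩ := hu r hr
    have h := (hasSum_uEx (by linarith) (hr2.trans_lt h2) φ).mul_right (radialWeight r)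
    rw [radialWeight, mul_one_div] at h
    refine h.congr_fun fun n => ?_
    rw [radialWeight]
    ring

lemma abs_Iu_sub_le {R : ℝ} (h1 : 1 / 2 ≤ R) (h2 : R < 1) (φ : ℝ) {m : ℕ}
    (hm : 2 ^ m * log 2 ≤ log (1 / (1 - R))) (hm' : log (1 / (1 - R)) ≤ 2 ^ (m + 1) * log 2) :
    |Iu uEx R φ - (log 2)⁻¹ * ∑ n ∈ Finset.range m, cos (gapExp n * φ)| ≤ 132 := by
  have hl2 := log_two_ge_half
  have hl2' : 0 < log 2 := by linarith
  have hR : 0 < 1 - R := by linarith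
  set ℓ := log (1 / (1 - R)) with hℓ
  have hℓ0 : 0 < ℓ := log_one_div_pos h1 h2
  have hexp : exp ℓ = 1 / (1 - R) := exp_log (by positivity)
  have hgap : ∀ n, (gapExp n : ℝ) = exp (2 ^ (n + 1) * log 2) := fun n => by
    rw [← log_gapExp, exp_log (by exact_mod_cast gapExp_pos n)]
  have hlt : ∀ n < m, (gapExp n : ℝ) * (1 - R) ≤ 1 := fun n hn => by
    rw [← le_div_iff₀ hR, ← hexp, hgap, exp_le_exp]
    refine le_trans ?_ hm
    gcongr
    · norm_num
    · omega
  have hge : ∀ n, m ≤ n → 1 ≤ (gapExp n : ℝ) * (1 - R) := fun n hn => by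
    rw [← div_le_iff₀ hR, ← hexp, hgap, exp_le_exp]
    refine hm'.trans ?_
    gcongr
    norm_num
  let b : ℕ → ℝ := fun n =>
    if n < m then 2 ^ (n + 1) * cos (gapExp n * φ) * ((2 ^ (n + 1) * log 2)⁻¹ - ℓ⁻¹) else 0
  have hb : HasSum b (∑ n ∈ Finset.range m, b n) :=
    hasSum_sum_of_ne_finset_zero fun n hn => if_neg (by simpa using hn)
  have hdiff := (hasSum_Iu h1 h2 φ).sub hb
  have hcos : ∀ (n : ℕ) (z : ℝ), |z| ≤ 32 / 4 ^ n →
      ‖2 ^ (n + 1) * cos (gapExp n * φ) * z‖ ≤ 64 * (1 / 2) ^ n := fun n z hz => by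
    rw [norm_eq_abs, abs_mul, abs_mul, abs_of_nonneg (by positivity : (0 : ℝ) ≤ 2 ^ (n + 1))]
    calc _ ≤ (2 : ℝ) ^ (n + 1) * 1 * (32 / 4 ^ n) := by gcongr; exact abs_cos_le_one _
      _ = _ := by
        rw [show (4 : ℝ) = 2 * 2 by norm_num, mul_pow, one_div, inv_pow]; field_simp; ring
  have hle : ∀ n, ‖2 ^ (n + 1) * cos (gapExp n * φ) *
      (∫ r in (1 / 2 : ℝ)..R, r ^ gapExp n * radialWeight r) - b n‖ ≤ 64 * (1 / 2) ^ n := by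
    intro n
    by_cases hn : n < m
    · simp only [b, if_pos hn]
      rw [← mul_sub]
      exact hcos n _ (abs_integral_pow_mul_radialWeight_sub_le n h2 (hlt n hn))
    · simp only [b, if_neg hn, sub_zero]
      exact hcos n _ (abs_integral_pow_mul_radialWeight_le n h1 h2 (hge n (not_lt.1 hn)))
  have hA : |Iu uEx R φ - ∑ n ∈ Finset.range m, b n| ≤ 128 := by
    have hg := hasSum_geometric_two.mul_left (64 : ℝ)
    have := tsum_of_norm_bounded hg hle
    rw [hdiff.tsum_eq] at this
    norm_num at this
    exact this
  have hB : |∑ n ∈ Finset.range m, b n -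
      (log 2)⁻¹ * ∑ n ∈ Finset.range m, cos (gapExp n * φ)| ≤ 4 := by
    rw [Finset.mul_sum, ← Finset.sum_sub_distrib]
    calc _ ≤ ∑ n ∈ Finset.range m, |b n - (log 2)⁻¹ * cos (gapExp n * φ)| :=
          Finset.abs_sum_le_sum_abs _ _
      _ ≤ ∑ n ∈ Finset.range m, 2 * ℓ⁻¹ * 2 ^ n := by
          refine Finset.sum_le_sum fun n hn => ?_
          simp only [b, if_pos (Finset.mem_range.1 hn)]
          have e : 2 ^ (n + 1) * cos (gapExp n * φ) * ((2 ^ (n + 1) * log 2)⁻¹ - ℓ⁻¹) -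
              (log 2)⁻¹ * cos (gapExp n * φ) = -(2 * ℓ⁻¹ * 2 ^ n * cos (gapExp n * φ)) := by
            rw [pow_succ]; field_simp; ring
          rw [e, abs_neg, abs_mul, abs_of_nonneg (by positivity : 0 ≤ 2 * ℓ⁻¹ * 2 ^ n)]
          exact mul_le_of_le_one_right (by positivity) (abs_cos_le_one _)
      _ = 2 * ℓ⁻¹ * (2 ^ m - 1) := by
          rw [← Finset.mul_sum, geom_sum_eq (by norm_num)]; norm_num
      _ ≤ 4 := by
          rw [mul_comm 2, mul_assoc, inv_mul_le_iff₀ hℓ0]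
          have : (0 : ℝ) < 2 ^ m := by positivity
          nlinarith
  calc _ ≤ |Iu uEx R φ - ∑ n ∈ Finset.range m, b n| + |∑ n ∈ Finset.range m, b n -
      (log 2)⁻¹ * ∑ n ∈ Finset.range m, cos (gapExp n * φ)| := abs_sub_le _ _ _
    _ ≤ 132 := by linarith

lemma cos_two_pi_mul_gapExp (n : ℕ) (φ : ℝ) :
    cos (2 * π * (gapExp n * ((φ + π) / (2 * π)))) = cos (gapExp n * φ) := by
  obtain ⟨k, hk⟩ := four_dvd_gapExp n
  rw [show 2 * π * (gapExp n * ((φ + π) / (2 * π))) =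
      gapExp n * φ + (2 * k : ℕ) * (2 * π) by
    rw [hk]; push_cast; have := pi_ne_zero; field_simp; ring]
  exact cos_add_nat_mul_two_pi _ _

lemma ae_eventually_sum_cos_le : ∀ᵐ φ ∂(volume.restrict (Ioc (-π) π)), ∀ᶠ m : ℕ in atTop,
    ∑ n ∈ Finset.range m, cos (gapExp n * φ) ≤ 4 * √(m * log (log m)) + 4 * π := by
  filter_upwards [ae_restrict_Ioc_of_ae_restrict_Ico
    isLILSequence_roundedCos.ae_eventually_sum_le] with φ hφ
  filter_upwards [hφ] with m hm
  have := abs_sum_roundedCos_sub_le m ((φ + π) / (2 * π))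
  simp only [cos_two_pi_mul_gapExp] at this
  linarith [(abs_le.1 this).1]

lemma ae_frequently_le_sum_cos : ∀ᵐ φ ∂(volume.restrict (Ioc (-π) π)), ∃ᶠ m : ℕ in atTop,
    √(m * log (log m)) / 100 - 4 * π ≤ ∑ n ∈ Finset.range m, cos (gapExp n * φ) := by
  filter_upwards [ae_restrict_Ioc_of_ae_restrict_Ico
    isLILSequence_roundedCos.ae_frequently_le_sum] with φ hφ
  refine hφ.mono fun m hm => ?_
  have := abs_sum_roundedCos_sub_le m ((φ + π) / (2 * π))
  simp only [cos_two_pi_mul_gapExp] at this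
  linarith [(abs_le.1 this).2]

lemma log_log_one_div_mem_Icc {R : ℝ} {m : ℕ} (h4 : 4 ≤ m)
    (hm : 2 ^ m * log 2 ≤ log (1 / (1 - R))) (hm' : log (1 / (1 - R)) ≤ 2 ^ (m + 1) * log 2) :
    log (log (1 / (1 - R))) ∈ Icc ((m : ℝ) / 4) m := by
  have hl2 := log_two_ge_half
  have hl2' := log_two_lt_d9
  have h0 : 0 < 2 ^ m * log 2 := by positivity
  have h4' : (4 : ℝ) ≤ m := by exact_mod_cast h4
  constructor
  · refine le_trans ?_ (log_le_log (by positivity : (0 : ℝ) < 2 ^ m * (1 / 2))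
      (le_trans (by gcongr) hm))
    rw [log_mul (by positivity) (by norm_num), log_pow, one_div, log_inv]
    nlinarith
  · refine (log_le_log (h0.trans_le hm) (hm'.trans
      (by gcongr; linarith : _ ≤ (2 : ℝ) ^ (m + 1) * 1))).trans ?_
    rw [mul_one, log_pow]
    push_cast
    nlinarith

lemma tendsto_log_log_natCast : Tendsto (fun m : ℕ => log (log m)) atTop atTop :=
  tendsto_log_atTop.comp (tendsto_log_atTop.comp tendsto_natCast_atTop_atTop)

lemma tendsto_sqrt_mul_log_log : Tendsto (fun m : ℕ => √(m * log (log m))) atTop atTop :=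
  tendsto_sqrt_atTop.comp (tendsto_natCast_atTop_atTop.atTop_mul_atTop₀ tendsto_log_log_natCast)

lemma eventually_mul_log_log_mem_Icc : ∀ᶠ m : ℕ in atTop, ∀ L ∈ Icc ((m : ℝ) / 4) m,
    L * log (log L) ∈ Icc (m * log (log m) / 9) (m * log (log m)) := by
  filter_upwards [tendsto_log_log_natCast.eventually_ge_atTop (2 * log 2),
    eventually_ge_atTop 16] with m hm h16 L ⟨hL1, hL2⟩
  have h16' : (16 : ℝ) ≤ m := by exact_mod_cast h16
  have hl2 := log_two_ge_half
  have hlogm : 0 < log m := log_pos (by linarith)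
  have hL0 : 0 < L := by linarith
  have hsq : (m : ℝ) ≤ L ^ 2 := by nlinarith
  have h1 : log m / 2 ≤ log L := by
    have := log_le_log (by linarith) hsq
    rw [log_pow] at this
    push_cast at this
    linarith
  have h2 : log (log m) / 2 ≤ log (log L) := by
    have := log_le_log (by positivity) h1
    rw [log_div hlogm.ne' two_ne_zero] at this
    linarith
  have h3 : log (log L) ≤ log (log m) :=
    log_le_log (by linarith) (log_le_log hL0 hL2)
  constructor
  · nlinarith
  · nlinarith

lemma rpow_neg_half_le {x y : ℝ} (hx : 0 < x) (h : x / 9 ≤ y) :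
    y ^ (-(1 / 2 : ℝ)) ≤ 3 / √x := by
  have hy : 0 < y := by linarith
  have h3 : √x ≤ 3 * √y := by
    rw [show (3 : ℝ) = √9 by rw [show (9 : ℝ) = 3 ^ 2 by norm_num]; simp,
      ← sqrt_mul (by norm_num)]
    exact sqrt_le_sqrt (by linarith)
  rw [rpow_neg hy.le, ← sqrt_eq_rpow, ← one_div,
    div_le_div_iff₀ (sqrt_pos.2 hy) (sqrt_pos.2 hx), one_mul]
  exact h3

lemma le_rpow_neg_half {x y : ℝ} (hy : 0 < y) (h : y ≤ x) :
    1 / √x ≤ y ^ (-(1 / 2 : ℝ)) := by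
  rw [rpow_neg hy.le, ← sqrt_eq_rpow, ← one_div]
  exact one_div_le_one_div_of_le (sqrt_pos.2 hy) (sqrt_le_sqrt h)

/-- `I_u(R, φ)` for `u = uEx`, normalised as in the law of the iterated logarithm. -/
noncomputable def normalizedIu (R φ : ℝ) : ℝ :=
  Iu uEx R φ * (log (log (1 / (1 - R))) *
    log (log (log (log (1 / (1 - R)))))) ^ (-(1/2 : ℝ))

lemma eventually_exists_pow_near (M : ℕ) : ∀ᶠ R in nhdsWithin (1 : ℝ) (Iio 1),
    1 / 2 ≤ R ∧ R < 1 ∧ ∃ m ≥ M, 2 ^ m * log 2 ≤ log (1 / (1 - R)) ∧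
      log (1 / (1 - R)) ≤ 2 ^ (m + 1) * log 2 := by
  have hl2 : 0 < log 2 := by linarith [log_two_ge_half]
  have hlt : 1 - exp (-(2 ^ M * log 2)) < 1 := by linarith [exp_pos (-(2 ^ M * log 2))]
  filter_upwards [Ioo_mem_nhdsLT hlt, Ioo_mem_nhdsLT (by norm_num : (1 / 2 : ℝ) < 1)]
    with R ⟨hR1, hR2⟩ ⟨hR3, _⟩
  refine ⟨hR3.le, hR2, ?_⟩
  have hR : 0 < 1 - R := by linarith
  have hℓ : 2 ^ M * log 2 ≤ log (1 / (1 - R)) := by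
    rw [one_div, log_inv, le_neg, log_le_iff_le_exp hR]
    linarith
  have hτ : 2 ^ M ≤ log (1 / (1 - R)) / log 2 := (le_div_iff₀ hl2).2 hℓ
  obtain ⟨m, hm, hm'⟩ := exists_nat_pow_near
    ((one_le_pow₀ (by norm_num : (1 : ℝ) ≤ 2) (n := M)).trans hτ) (by norm_num : (1 : ℝ) < 2)
  refine ⟨m, ?_, (le_div_iff₀ hl2).1 hm, ((div_lt_iff₀ hl2).1 hm').le⟩
  have := (pow_lt_pow_iff_right₀ (by norm_num : (1 : ℝ) < 2)).1 (hτ.trans_lt hm')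
  omega

lemma eventually_normalizedIu_le {φ : ℝ} (h : ∀ᶠ m : ℕ in atTop,
    ∑ n ∈ Finset.range m, cos (gapExp n * φ) ≤ 4 * √(m * log (log m)) + 4 * π) :
    ∀ᶠ R in nhdsWithin (1 : ℝ) (Iio 1), normalizedIu R φ ≤ 504 := by
  obtain ⟨M, hM⟩ := eventually_atTop.1 (h.and (eventually_mul_log_log_mem_Icc.and
    (tendsto_sqrt_mul_log_log.eventually_ge_atTop 1)))
  filter_upwards [eventually_exists_pow_near (max M 4)] with R ⟨h1, h2, m, hmM, hm, hm'⟩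
  obtain ⟨hsum, hD, hG⟩ := hM m (le_of_max_le_left hmM)
  obtain ⟨hD1, hD2⟩ := hD _ (log_log_one_div_mem_Icc (le_of_max_le_right hmM) hm hm')
  have hI := (abs_le.1 (abs_Iu_sub_le h1 h2 φ hm hm')).2
  set G := √(m * log (log m)) with hGdef
  have hpos : 0 < (m : ℝ) * log (log m) := sqrt_pos.1 (by linarith)
  have hinv : (log 2)⁻¹ ≤ 2 := by
    rw [inv_le_comm₀ (by linarith [log_two_ge_half]) two_pos]
    linarith [log_two_ge_half]
  have hpi := pi_lt_d2
  have hC : (log 2)⁻¹ * ∑ n ∈ Finset.range m, cos (gapExp n * φ) ≤ 2 * (4 * G + 4 * π) :=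
    calc _ ≤ (log 2)⁻¹ * (4 * G + 4 * π) := by
          gcongr
      _ ≤ _ := by gcongr
  have hI' : Iu uEx R φ ≤ 168 * G := by linarith
  calc normalizedIu R φ ≤ 168 * G * (3 / G) := by
        refine mul_le_mul hI' (rpow_neg_half_le hpos hD1) (rpow_nonneg ?_ _) (by positivity)
        linarith
    _ = 504 := by field_simp; norm_num

lemma tendsto_one_sub_one_div_two_pow_two_pow :
    Tendsto (fun m : ℕ => 1 - 1 / (2 : ℝ) ^ 2 ^ m) atTop (nhdsWithin 1 (Iio 1)) := by
  refine tendsto_nhdsWithin_iff.2 ⟨?_, Eventually.of_forall fun m => ?_⟩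
  · have h1 : Tendsto (fun m : ℕ => (1 / 2 : ℝ) ^ 2 ^ m) atTop (nhds 0) :=
      (tendsto_pow_atTop_nhds_zero_of_lt_one (by norm_num) (by norm_num)).comp
        (tendsto_pow_atTop_atTop_of_one_lt one_lt_two)
    simpa using h1.const_sub 1
  · have : 0 < 1 / (2 : ℝ) ^ 2 ^ m := by positivity
    simp only [mem_Iio]
    linarith

lemma frequently_le_normalizedIu {φ : ℝ} (h : ∃ᶠ m : ℕ in atTop,
    √(m * log (log m)) / 100 - 4 * π ≤ ∑ n ∈ Finset.range m, cos (gapExp n * φ)) :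
    ∃ᶠ R in nhdsWithin (1 : ℝ) (Iio 1), 1 / 200 ≤ normalizedIu R φ := by
  refine tendsto_one_sub_one_div_two_pow_two_pow.frequently ?_
  refine (h.and_eventually (eventually_mul_log_log_mem_Icc.and
    ((tendsto_sqrt_mul_log_log.eventually_ge_atTop 30000).and
      (eventually_ge_atTop 4)))).mono fun m ⟨hsum, hD, hG, h4⟩ => ?_
  have hℓ : log (1 / (1 - (1 - 1 / (2 : ℝ) ^ 2 ^ m))) = 2 ^ m * log 2 := by
    rw [sub_sub_cancel, one_div_one_div, log_pow]
    push_cast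
    rfl
  have hl2 := log_two_ge_half
  have hl2' := log_two_lt_d9
  have h1 : 1 / 2 ≤ 1 - 1 / (2 : ℝ) ^ 2 ^ m := by
    have : (1 : ℝ) / 2 ^ 2 ^ m ≤ 1 / 2 := by
      gcongr
      exact le_self_pow₀ (by norm_num) (by positivity)
    linarith
  have h2 : 1 - 1 / (2 : ℝ) ^ 2 ^ m < 1 := by
    have : 0 < (1 : ℝ) / 2 ^ 2 ^ m := by positivity
    linarith
  generalize 1 - 1 / (2 : ℝ) ^ 2 ^ m = R at *
  have hm : 2 ^ m * log 2 ≤ log (1 / (1 - R)) := hℓ.ge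
  have hm' : log (1 / (1 - R)) ≤ 2 ^ (m + 1) * log 2 := by
    rw [hℓ]
    gcongr <;> norm_num
  obtain ⟨hD1, hD2⟩ := hD _ (log_log_one_div_mem_Icc h4 hm hm')
  have hI := (abs_le.1 (abs_Iu_sub_le h1 h2 φ hm hm')).1
  set G := √(m * log (log m)) with hGdef
  have hpos : 0 < (m : ℝ) * log (log m) := sqrt_pos.1 (by linarith)
  have hpi := pi_lt_d2
  have hinv : 1 ≤ (log 2)⁻¹ := (one_le_inv₀ (by linarith)).2 (by linarith)
  have hC : ∑ n ∈ Finset.range m, cos (gapExp n * φ) ≤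
      (log 2)⁻¹ * ∑ n ∈ Finset.range m, cos (gapExp n * φ) :=
    le_mul_of_one_le_left (by linarith) hinv
  have hI' : G / 200 ≤ Iu uEx R φ := by linarith
  calc (1 / 200 : ℝ) = G / 200 * (1 / G) := by field_simp
    _ ≤ normalizedIu R φ :=
      mul_le_mul hI' (le_rpow_neg_half (by linarith) hD2) (by positivity) (by linarith)

theorem stmt_2 :
    ∃ α : ℝ, 0 < α ∧
      ∀ᵐ φ ∂(volume.restrict (Ioc (-π) π)),
        α < Filter.limsup
          (fun R : ℝ => Iu uEx R φ *
            (Real.log (Real.log (1 / (1 - R))) *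
              Real.log (Real.log (Real.log (Real.log (1 / (1 - R)))))) ^ (-(1/2 : ℝ)))
          (nhdsWithin 1 (Iio 1)) := by
  refine ⟨1 / 400, by norm_num, ?_⟩
  filter_upwards [ae_eventually_sum_cos_le, ae_frequently_le_sum_cos] with φ hup hlow
  refine lt_of_lt_of_le (by norm_num : (1 / 400 : ℝ) < 1 / 200) ?_
  exact le_limsup_of_frequently_le (frequently_le_normalizedIu hlow)
    (isBoundedUnder_of_eventually_le (eventually_normalizedIu_le hup))
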